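/- Let p > 2 and α ≥ -1. The following are equivalent: (a) ‖f‖_{A^p_{(p/2)(α+2)−2}} ≤ ‖f‖_{A²_α} for every f holomorphic on 𝔻 (the inclusion A²_α ⊂ A^p_{(p/2)(α+2)−2} is contractive); (b) for every f holomorphic on 𝔻 with ‖f‖_{A²_α} = 1 there exists g holomorphic on 𝔻 with ‖g‖_{A²_α} = 1 and |g(0)| = sup_{z ∈ 𝔻} |g(z)|(1−|z|²)^{(α+2)/2} such that F_p(f) ≤ F_p(g). -/

import Mathlib

open MeasureTheory Set Filter
open scoped ENNReal NNReal Topology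

noncomputable section

/-- The open unit disk in `ℂ`. -/
def unitDisk : Set ℂ := Metric.ball 0 1

/-- `c_β(n) = Γ(n+β)/(Γ(β)·n!)`. -/
def ccoef (β : ℝ) (n : ℕ) : ℝ := Real.Gamma (n + β) / (Real.Gamma β * n.factorial)

/-- The `n`-th Taylor coefficient of `f` at the origin. -/
def taylorCoeff (f : ℂ → ℂ) (n : ℕ) : ℂ := iteratedDeriv n f 0 / n.factorial

/-- The square of the `A²_α` norm, `∑ |a_n|²/c_{α+2}(n)`, valued in `[0,∞]`. -/
def A2normSq (α : ℝ) (f : ℂ → ℂ) : ℝ≥0∞ :=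
  ∑' n : ℕ, ENNReal.ofReal (‖taylorCoeff f n‖ ^ 2 / ccoef (α + 2) n)

/-- The `A²_α` norm (Hardy `H²` norm when `α = -1`). -/
def A2norm (α : ℝ) (f : ℂ → ℂ) : ℝ≥0∞ := A2normSq α f ^ (1 / 2 : ℝ)

/-- The `p`-th power of the weighted Bergman norm `‖f‖_{A^p_β}`, valued in `[0,∞]`:
`(β+1) ∫_𝔻 (1-|z|²)^β |f z|^p dA(z)` with `dA` the normalized area measure. -/
def ApIntPow (p β : ℝ) (f : ℂ → ℂ) : ℝ≥0∞ :=
  ENNReal.ofReal (β + 1) *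
    (∫⁻ z in unitDisk, ENNReal.ofReal ((1 - ‖z‖ ^ 2) ^ β * ‖f z‖ ^ p)) / ENNReal.ofReal Real.pi

/-- The weighted Bergman norm `‖f‖_{A^p_β}`, valued in `[0,∞]`. -/
def ApNorm (p β : ℝ) (f : ℂ → ℂ) : ℝ≥0∞ := ApIntPow p β f ^ (1 / p)

/-- The inner integral `∫₀¹ s^{α+1}/(1-(1-|z|²)s) ds`, valued in `[0,∞]`. -/
def Hinner (α : ℝ) (z : ℂ) : ℝ≥0∞ :=
  ∫⁻ s in Set.Ioo (0 : ℝ) 1, ENNReal.ofReal (s ^ (α + 1) / (1 - (1 - ‖z‖ ^ 2) * s))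

/-- The quantity `F_p(f)`. -/
def Ffun (α p : ℝ) (f : ℂ → ℂ) : ℝ≥0∞ :=
  ENNReal.ofReal (‖f 0‖ ^ p) +
    ENNReal.ofReal (p / 2) *
      (∫⁻ z in unitDisk,
        ENNReal.ofReal (‖deriv f z‖ ^ 2 * ‖f z‖ ^ (p - 2) * (1 - ‖z‖ ^ 2) ^ (p * (α + 2) / 2)) *
          Hinner α z) / ENNReal.ofReal Real.pi

/-- The quantity `G_p(f)`. -/
def Gfun (α p : ℝ) (f : ℂ → ℂ) : ℝ≥0∞ :=
  ENNReal.ofReal (p / (2 * (α + 2))) *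
    (∫⁻ z in unitDisk,
      ENNReal.ofReal (‖deriv f z‖ ^ 2 * ‖f z‖ ^ (p - 2) * (1 - ‖z‖ ^ 2) ^ (p * (α + 2) / 2))) /
    ENNReal.ofReal Real.pi

theorem lintegral_Ioo_of_hasDerivAt {G g : ℝ → ℝ} {a b : ℝ} (hab : a ≤ b)
    (hG : ContinuousOn G (Icc a b)) (hd : ∀ x ∈ Ioo a b, HasDerivAt G (g x) x)
    (hg : ∀ x ∈ Ioo a b, 0 ≤ g x) :
    ∫⁻ x in Ioo a b, ENNReal.ofReal (g x) = ENNReal.ofReal (G b - G a) := by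
  have hi : IntegrableOn g (Ioc a b) := intervalIntegral.integrableOn_deriv_of_nonneg hG hd hg
  have h1 : ∫ x in a..b, g x = G b - G a :=
    intervalIntegral.integral_eq_sub_of_hasDerivAt_of_le hab hG hd
      ((intervalIntegrable_iff_integrableOn_Ioc_of_le hab).2 hi)
  rw [← h1, intervalIntegral.integral_of_le hab, integral_Ioc_eq_integral_Ioo,
    ofReal_integral_eq_lintegral_ofReal (hi.mono_set Ioo_subset_Ioc_self)]
  exact (ae_restrict_iff' measurableSet_Ioo).2 (Eventually.of_forall hg)

theorem lintegral_rpow_Ioo {c r : ℝ} (hc : 0 < c) (hr : 0 ≤ r) :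
    ∫⁻ s in Ioo (0 : ℝ) r, ENNReal.ofReal (s ^ (c - 1)) = ENNReal.ofReal (r ^ c / c) := by
  rw [lintegral_Ioo_of_hasDerivAt (G := fun s => s ^ c / c) hr]
  · simp [Real.zero_rpow hc.ne']
  · exact (ContinuousOn.rpow_const continuousOn_id (fun x _ => Or.inr hc.le)).div_const _
  · intro x hx
    have := (Real.hasDerivAt_rpow_const (x := x) (p := c) (Or.inl hx.1.ne')).div_const c
    rwa [mul_div_cancel_left₀ _ hc.ne'] at this
  · intro x hx
    exact Real.rpow_nonneg hx.1.le _

theorem lintegral_pow_Ioo (n : ℕ) {r : ℝ} (hr : 0 ≤ r) :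
    ∫⁻ s in Ioo (0 : ℝ) r, ENNReal.ofReal (s ^ n) = ENNReal.ofReal (r ^ (n + 1) / (n + 1)) := by
  have := lintegral_rpow_Ioo (c := n + 1) (by positivity) hr
  simpa [← Real.rpow_natCast] using this

theorem lintegral_mul_one_sub_sq_rpow {c r : ℝ} (hc : 0 < c) (hr : 0 ≤ r) (hr1 : r ≤ 1) :
    ∫⁻ t in Ioo r 1, ENNReal.ofReal (t * (1 - t ^ 2) ^ (c - 1)) =
      ENNReal.ofReal ((1 - r ^ 2) ^ c / (2 * c)) := by
  rw [lintegral_Ioo_of_hasDerivAt (G := fun t => -((1 - t ^ 2) ^ c / (2 * c))) hr1]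
  · simp [Real.zero_rpow hc.ne']
  · exact ((ContinuousOn.rpow_const (by fun_prop) (fun x _ => Or.inr hc.le)).div_const _).neg
  · intro x hx
    have hpos : 0 < 1 - x ^ 2 := by nlinarith [hx.1, hx.2]
    have h1 : HasDerivAt (fun t : ℝ => 1 - t ^ 2) (-(2 * x)) x := by
      simpa using (hasDerivAt_pow 2 x).const_sub 1
    have := ((h1.rpow_const (p := c) (Or.inl hpos.ne')).div_const (2 * c)).neg
    refine this.congr_deriv ?_
    field_simp
  · intro x hx
    have hpos : 0 < 1 - x ^ 2 := by nlinarith [hx.1, hx.2]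
    have : 0 < x := hr.trans_lt hx.1
    positivity

/-- The series `∑ y^k/(c+k)`, which is `∫₀¹ s^{c-1}/(1-ys) ds`. -/
def kernelSeries (c y : ℝ) : ℝ≥0∞ := ∑' k : ℕ, ENNReal.ofReal (y ^ k / (c + k))

theorem measurable_kernelSeries (c : ℝ) : Measurable (kernelSeries c) := by
  unfold kernelSeries
  fun_prop

theorem one_div_one_sub_eq_tsum {x : ℝ} (h0 : 0 ≤ x) (h1 : x < 1) :
    ENNReal.ofReal (1 / (1 - x)) = ∑' k : ℕ, ENNReal.ofReal (x ^ k) := by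
  rw [← ENNReal.ofReal_tsum_of_nonneg (fun k => by positivity) (summable_geometric_of_lt_one h0 h1),
    tsum_geometric_of_lt_one h0 h1, one_div]

theorem hinner_eq_kernelSeries {α : ℝ} (hα : -2 < α) {z : ℂ} (hz : z ∈ unitDisk) :
    Hinner α z = kernelSeries (α + 2) (1 - ‖z‖ ^ 2) := by
  have hz1 : ‖z‖ < 1 := by simpa [unitDisk] using hz
  set y := 1 - ‖z‖ ^ 2 with hy
  have hy0 : 0 ≤ y := by nlinarith [norm_nonneg z]
  have hy1 : y ≤ 1 := by nlinarith [norm_nonneg z]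
  have : Hinner α z = ∫⁻ s in Ioo (0 : ℝ) 1,
      ∑' k : ℕ, ENNReal.ofReal (y ^ k) * ENNReal.ofReal (s ^ ((α + 2 + k) - 1)) := by
    refine setLIntegral_congr_fun measurableSet_Ioo (fun s hs => ?_)
    have h0 : 0 ≤ y * s := mul_nonneg hy0 hs.1.le
    have h1 : y * s < 1 := by nlinarith [hs.1, hs.2]
    simp only [← hy]
    rw [div_eq_mul_one_div, ENNReal.ofReal_mul (Real.rpow_nonneg hs.1.le _),
      one_div_one_sub_eq_tsum h0 h1, ← ENNReal.tsum_mul_left]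
    congr 1
    ext k
    rw [← ENNReal.ofReal_mul (Real.rpow_nonneg hs.1.le _), ← ENNReal.ofReal_mul (by positivity),
      mul_pow]
    congr 1
    rw [show α + 2 + k - 1 = α + 1 + k by ring, Real.rpow_add_natCast hs.1.ne']
    ring
  rw [this, lintegral_tsum (fun k => by fun_prop), kernelSeries]
  congr 1
  ext k
  have hk : 0 < α + 2 + k := by have : (0 : ℝ) ≤ k := k.cast_nonneg; linarith
  rw [lintegral_const_mul _ (by fun_prop), lintegral_rpow_Ioo hk zero_le_one,
    ← ENNReal.ofReal_mul (by positivity)]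
  simp [div_eq_mul_inv]

theorem lintegral_kernel {c r : ℝ} (hc : 0 < c) (hr : 0 < r) (hr1 : r < 1) :
    ∫⁻ t in Ioo r 1, ENNReal.ofReal ((1 - t ^ 2) ^ (c - 1) / t) =
      ENNReal.ofReal ((1 - r ^ 2) ^ c / 2) * kernelSeries c (1 - r ^ 2) := by
  have hy0 : 0 < 1 - r ^ 2 := by nlinarith
  have : ∫⁻ t in Ioo r 1, ENNReal.ofReal ((1 - t ^ 2) ^ (c - 1) / t) = ∫⁻ t in Ioo r 1,
      ∑' k : ℕ, ENNReal.ofReal (t * (1 - t ^ 2) ^ ((c + k) - 1)) := by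
    refine setLIntegral_congr_fun measurableSet_Ioo (fun t ht => ?_)
    have ht0 : 0 < t := hr.trans ht.1
    have hpos : 0 < 1 - t ^ 2 := by nlinarith [ht.1, ht.2]
    have : (1 - t ^ 2) ^ (c - 1) / t = t * (1 - t ^ 2) ^ (c - 1) * (1 / (1 - (1 - t ^ 2))) := by
      field_simp
      ring
    simp only [this]
    rw [ENNReal.ofReal_mul (by positivity), one_div_one_sub_eq_tsum hpos.le (by nlinarith),
      ← ENNReal.tsum_mul_left]
    congr 1
    ext k
    rw [← ENNReal.ofReal_mul (by positivity)]
    congr 1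
    rw [show c + k - 1 = c - 1 + k by ring, Real.rpow_add_natCast hpos.ne']
    ring
  rw [this, lintegral_tsum (fun k => by fun_prop), kernelSeries, ← ENNReal.tsum_mul_left]
  congr 1
  ext k
  rw [lintegral_mul_one_sub_sq_rpow (by positivity) hr.le hr1.le,
    ← ENNReal.ofReal_mul (by positivity), Real.rpow_add_natCast hy0.ne']
  congr 1
  field_simp

theorem lintegral_beta (m : ℕ) : ∀ {c : ℝ}, 0 < c →
    ∫⁻ t in Ioo (0 : ℝ) 1, ENNReal.ofReal (t ^ (2 * m + 1) * (1 - t ^ 2) ^ (c - 1)) =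
      ENNReal.ofReal (m.factorial * Real.Gamma c / (2 * Real.Gamma (m + 1 + c))) := by
  induction m with
  | zero =>
    intro c hc
    have h := lintegral_mul_one_sub_sq_rpow hc le_rfl zero_le_one
    simp only [mul_zero, zero_add, pow_one, h]
    have := Real.Gamma_pos_of_pos hc
    rw [show ((0 : ℕ) : ℝ) + 1 + c = c + 1 by push_cast; ring, Real.Gamma_add_one hc.ne']
    congr 1
    simp
    field_simp
  | succ m ih =>
    intro c hc
    have h1 := ih hc
    have h2 := ih (c := c + 1) (by positivity)
    have hs : ∫⁻ t in Ioo (0 : ℝ) 1, ENNReal.ofReal (t ^ (2 * m + 1) * (1 - t ^ 2) ^ (c - 1)) =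
        (∫⁻ t in Ioo (0 : ℝ) 1,
          ENNReal.ofReal (t ^ (2 * (m + 1) + 1) * (1 - t ^ 2) ^ (c - 1))) +
        ∫⁻ t in Ioo (0 : ℝ) 1,
          ENNReal.ofReal (t ^ (2 * m + 1) * (1 - t ^ 2) ^ (c + 1 - 1)) := by
      rw [← lintegral_add_left (by fun_prop)]
      refine setLIntegral_congr_fun measurableSet_Ioo (fun t ht => ?_)
      have ht0 : 0 < t := ht.1
      have hpos : 0 < 1 - t ^ 2 := by nlinarith [ht.1, ht.2]
      rw [← ENNReal.ofReal_add (by positivity) (by positivity)]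
      congr 1
      rw [show c + 1 - 1 = c - 1 + 1 by ring, Real.rpow_add_one hpos.ne']
      ring
    rw [h1, h2] at hs
    refine (ENNReal.add_left_inj (ENNReal.ofReal_ne_top)).1 (hs.symm.trans ?_)
    have g1 := Real.Gamma_pos_of_pos hc
    have g2 : 0 < Real.Gamma (m + 1 + c) := Real.Gamma_pos_of_pos (by positivity)
    have e1 : Real.Gamma (((m + 1 : ℕ) : ℝ) + 1 + c) = (m + 1 + c) * Real.Gamma (m + 1 + c) := by
      rw [← Real.Gamma_add_one (by positivity)]
      congr 1
      push_cast
      ring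
    have e2 : Real.Gamma (m + 1 + (c + 1)) = (m + 1 + c) * Real.Gamma (m + 1 + c) := by
      rw [← Real.Gamma_add_one (by positivity)]
      congr 1
      ring
    rw [e1, e2, Real.Gamma_add_one hc.ne', ← ENNReal.ofReal_add (by positivity) (by positivity)]
    congr 1
    rw [Nat.factorial_succ]
    push_cast
    field_simp

theorem lintegral_triangle_swap {u w : ℝ → ℝ≥0∞} (hu : Measurable u) (hw : Measurable w) :
    ∫⁻ r in Ioo (0 : ℝ) 1, w r * ∫⁻ t in Ioo (0 : ℝ) r, u t =
      ∫⁻ t in Ioo (0 : ℝ) 1, u t * ∫⁻ r in Ioo t 1, w r := by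
  have hT : MeasurableSet {q : ℝ × ℝ | q.2 < q.1} := measurableSet_lt measurable_snd measurable_fst
  have hm : Measurable ({q : ℝ × ℝ | q.2 < q.1}.indicator fun q => w q.1 * u q.2) :=
    (Measurable.mul (by fun_prop) (by fun_prop)).indicator hT
  have key := lintegral_lintegral_swap (μ := volume.restrict (Ioo (0 : ℝ) 1))
    (ν := volume.restrict (Ioo (0 : ℝ) 1))
    (f := fun r t => {q : ℝ × ℝ | q.2 < q.1}.indicator (fun q => w q.1 * u q.2) (r, t))
    hm.aemeasurable
  convert key using 1
  · refine setLIntegral_congr_fun measurableSet_Ioo (fun r hr => ?_)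
    rw [← lintegral_const_mul _ hu, ← lintegral_indicator measurableSet_Ioo,
      ← lintegral_indicator measurableSet_Ioo]
    congr 1
    ext t
    simp only [indicator, mem_Ioo, Set.mem_ofPred_eq]
    have := hr.2
    split_ifs <;> first | rfl | (exfalso; grind)
  · refine setLIntegral_congr_fun measurableSet_Ioo (fun t ht => ?_)
    rw [← lintegral_const_mul _ hw, ← lintegral_indicator measurableSet_Ioo,
      ← lintegral_indicator measurableSet_Ioo]
    congr 1
    ext r
    simp only [indicator, mem_Ioo, Set.mem_ofPred_eq]
    have := ht.1
    split_ifs <;> first | exact mul_comm _ _ | rfl | (exfalso; grind)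

theorem isOpen_unitDisk : IsOpen unitDisk := Metric.isOpen_ball

theorem mem_unitDisk {z : ℂ} : z ∈ unitDisk ↔ ‖z‖ < 1 := by simp [unitDisk]

theorem circleMap_mem_unitDisk {r : ℝ} (hr : 0 ≤ r) (hr1 : r < 1) (θ : ℝ) :
    circleMap 0 r θ ∈ unitDisk := by
  rw [mem_unitDisk, norm_circleMap_zero, abs_of_nonneg hr]
  exact hr1

theorem setLIntegral_unitDisk_polar {g : ℂ → ℝ≥0∞} (hg : Measurable (unitDisk.indicator g)) :
    ∫⁻ z in unitDisk, g z = ∫⁻ r in Ioo (0 : ℝ) 1, ENNReal.ofReal r *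
      ∫⁻ θ in Ioo (-Real.pi) Real.pi, g (circleMap 0 r θ) := by
  have hm : Measurable fun q : ℝ × ℝ =>
      ENNReal.ofReal q.1 * unitDisk.indicator g (circleMap 0 q.1 q.2) := by
    have : Measurable fun q : ℝ × ℝ => circleMap 0 q.1 q.2 := by
      unfold circleMap
      fun_prop
    exact (by fun_prop : Measurable fun q : ℝ × ℝ => ENNReal.ofReal q.1).mul (hg.comp this)
  rw [← lintegral_indicator isOpen_unitDisk.measurableSet, ← Complex.lintegral_comp_polarCoord_symm]
  have h1 : ∀ q : ℝ × ℝ, Complex.polarCoord.symm q = circleMap 0 q.1 q.2 := by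
    intro q
    rw [Complex.polarCoord_symm_apply, circleMap_zero, Complex.exp_mul_I]
    simp
  simp_rw [h1, smul_eq_mul, polarCoord_target, Measure.volume_eq_prod]
  rw [setLIntegral_prod _ hm.aemeasurable, ← lintegral_indicator measurableSet_Ioi,
    ← lintegral_indicator measurableSet_Ioo]
  congr 1
  ext r
  by_cases hr : 0 < r
  · by_cases hr1 : r < 1
    · rw [indicator_of_mem (mem_Ioi.2 hr), indicator_of_mem (mem_Ioo.2 ⟨hr, hr1⟩),
        lintegral_const_mul' _ _ ENNReal.ofReal_ne_top]
      simp_rw [indicator_of_mem (circleMap_mem_unitDisk hr.le hr1 _)]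
    · rw [indicator_of_mem (mem_Ioi.2 hr), indicator_of_notMem (fun h => hr1 h.2)]
      have : ∀ θ, circleMap 0 r θ ∉ unitDisk := by
        intro θ
        rw [mem_unitDisk, norm_circleMap_zero, abs_of_pos hr]
        exact hr1
      simp_rw [indicator_of_notMem (this _)]
      simp
  · rw [indicator_of_notMem (show r ∉ Ioi 0 from hr), indicator_of_notMem (fun h => hr h.1)]

theorem measurable_indicator_unitDisk {c : ℂ → ℝ} (hc : ContinuousOn c unitDisk) {K : ℝ → ℝ≥0∞}
    (hK : Measurable K) :
    Measurable (unitDisk.indicator fun z => K ‖z‖ * ENNReal.ofReal (c z)) := by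
  classical
  have h1 : Measurable (unitDisk.indicator c) := by
    rw [← piecewise_eq_indicator]
    exact hc.measurable_piecewise continuousOn_const isOpen_unitDisk.measurableSet
  have h2 : (unitDisk.indicator fun z => K ‖z‖ * ENNReal.ofReal (c z)) =
      fun z => K ‖z‖ * ENNReal.ofReal (unitDisk.indicator c z) := by
    ext z
    by_cases hz : z ∈ unitDisk <;> simp [hz]
  rw [h2]
  exact (hK.comp measurable_norm).mul h1.ennreal_ofReal

theorem setLIntegral_unitDisk_radial_mul {c : ℂ → ℝ} (hc : ContinuousOn c unitDisk)
    {K : ℝ → ℝ≥0∞} (hK : Measurable K) :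
    ∫⁻ z in unitDisk, K ‖z‖ * ENNReal.ofReal (c z) = ∫⁻ r in Ioo (0 : ℝ) 1, ENNReal.ofReal r *
      (K r * ∫⁻ θ in Ioo (-Real.pi) Real.pi, ENNReal.ofReal (c (circleMap 0 r θ))) := by
  rw [setLIntegral_unitDisk_polar (measurable_indicator_unitDisk hc hK)]
  refine setLIntegral_congr_fun measurableSet_Ioo (fun r hr => ?_)
  have hcont : ContinuousOn (fun θ : ℝ => c (circleMap 0 r θ)) univ :=
    hc.comp (continuous_circleMap 0 r).continuousOn
      (fun θ _ => circleMap_mem_unitDisk hr.1.le hr.2 θ)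
  rw [continuousOn_univ] at hcont
  rw [← lintegral_const_mul _ hcont.measurable.ennreal_ofReal]
  simp only [norm_circleMap_zero, abs_of_pos hr.1]

theorem integral_exp_mul_exp_neg (k n : ℕ) :
    ∫ θ in (-Real.pi)..Real.pi, Complex.exp (k * θ * Complex.I) *
      (starRingEnd ℂ) (Complex.exp (n * θ * Complex.I)) =
      if k = n then 2 * (Real.pi : ℂ) else 0 := by
  have h : ∀ θ : ℝ, Complex.exp (k * θ * Complex.I) *
      (starRingEnd ℂ) (Complex.exp (n * θ * Complex.I)) =
      Complex.exp ((((k : ℂ) - n) * Complex.I) * θ) := by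
    intro θ
    rw [← Complex.exp_conj, ← Complex.exp_add]
    congr 1
    simp
    ring
  simp_rw [h]
  split_ifs with hkn
  · subst hkn
    simp
    ring
  · have h0 : ((k : ℂ) - n) * Complex.I ≠ 0 := by
      refine mul_ne_zero (sub_ne_zero.2 (by exact_mod_cast hkn)) Complex.I_ne_zero
    rw [integral_exp_mul_complex h0, div_eq_zero_iff]
    left
    rw [sub_eq_zero, Complex.exp_eq_exp_iff_exists_int]
    refine ⟨(k : ℤ) - n, ?_⟩
    push_cast
    ring

theorem hasSum_integral_trigSeries_mul {c : ℕ → ℂ} (hc : Summable fun n => ‖c n‖) {ψ : ℝ → ℂ}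
    (hψ : Continuous ψ) :
    HasSum (fun n : ℕ => ∫ θ in (-Real.pi)..Real.pi, c n * Complex.exp (n * θ * Complex.I) * ψ θ)
      (∫ θ in (-Real.pi)..Real.pi, (∑' n : ℕ, c n * Complex.exp (n * θ * Complex.I)) * ψ θ) := by
  have hn : ∀ (n : ℕ) (θ : ℝ), ‖c n * Complex.exp (n * θ * Complex.I)‖ = ‖c n‖ := by
    intro n θ
    rw [norm_mul, ← Complex.ofReal_natCast, ← Complex.ofReal_mul, Complex.norm_exp_ofReal_mul_I,
      mul_one]
  refine intervalIntegral.hasSum_integral_of_dominated_convergence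
    (fun n θ => ‖c n‖ * ‖ψ θ‖) (fun n => ?_) (fun n => ?_) ?_ ?_ ?_
  · exact Continuous.aestronglyMeasurable (by fun_prop)
  · refine ae_of_all _ fun θ _ => ?_
    rw [norm_mul, hn]
  · exact ae_of_all _ fun θ _ => hc.mul_right _
  · refine Continuous.intervalIntegrable ?_ _ _
    simp_rw [tsum_mul_right]
    fun_prop
  · refine ae_of_all _ fun θ _ => ?_
    refine HasSum.mul_right _ (Summable.hasSum (Summable.of_norm ?_))
    simpa only [hn] using hc

theorem continuous_trigSeries {c : ℕ → ℂ} (hc : Summable fun n => ‖c n‖) :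
    Continuous fun θ : ℝ => ∑' n : ℕ, c n * Complex.exp (n * θ * Complex.I) := by
  refine continuous_tsum (fun n => by fun_prop) hc (fun n θ => ?_)
  rw [norm_mul, ← Complex.ofReal_natCast, ← Complex.ofReal_mul, Complex.norm_exp_ofReal_mul_I,
    mul_one]

theorem integral_trigSeries_mul_conj {c : ℕ → ℂ} (hc : Summable fun n => ‖c n‖) (n : ℕ) :
    ∫ θ in (-Real.pi)..Real.pi, (∑' k : ℕ, c k * Complex.exp (k * θ * Complex.I)) *
      (starRingEnd ℂ) (Complex.exp (n * θ * Complex.I)) = c n * (2 * Real.pi) := by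
  rw [← (hasSum_integral_trigSeries_mul hc (ψ := fun θ => (starRingEnd ℂ)
    (Complex.exp (n * θ * Complex.I))) (by fun_prop)).tsum_eq]
  simp_rw [mul_assoc (c _), intervalIntegral.integral_const_mul, ← mul_assoc]
  have := fun k => integral_exp_mul_exp_neg k n
  simp_rw [this]
  rw [tsum_eq_single n]
  · simp [mul_assoc]
  · intro k hk
    simp [hk]

theorem hasSum_parseval {c : ℕ → ℂ} (hc : Summable fun n => ‖c n‖) :
    HasSum (fun n => 2 * Real.pi * ‖c n‖ ^ 2)
      (∫ θ in (-Real.pi)..Real.pi, ‖∑' n : ℕ, c n * Complex.exp (n * θ * Complex.I)‖ ^ 2) := by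
  set F : ℝ → ℂ := fun θ => ∑' n : ℕ, c n * Complex.exp (n * θ * Complex.I) with hF
  have hFc : Continuous F := continuous_trigSeries hc
  have h := hasSum_integral_trigSeries_mul hc (ψ := fun θ => (starRingEnd ℂ) (F θ)) (by fun_prop)
  rw [← Complex.hasSum_ofReal, ← intervalIntegral.integral_ofReal]
  convert h using 1
  · ext n
    have h2 := congrArg (starRingEnd ℂ) (integral_trigSeries_mul_conj hc n)
    simp_rw [mul_assoc (c n), intervalIntegral.integral_const_mul]
    have h3 : ∫ θ in (-Real.pi)..Real.pi, Complex.exp (n * θ * Complex.I) *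
        (starRingEnd ℂ) (F θ) = (starRingEnd ℂ) (c n * (2 * Real.pi)) := by
      rw [← h2, ← intervalIntegral.intervalIntegral_conj]
      refine intervalIntegral.integral_congr (fun θ _ => ?_)
      simp only [map_mul, Complex.conj_conj, hF]
      ring
    rw [h3]
    push_cast
    rw [map_mul, ← mul_assoc, Complex.mul_conj']
    rw [map_mul, Complex.conj_ofReal, map_ofNat]
    ring
  · refine intervalIntegral.integral_congr (fun θ _ => ?_)
    rw [Complex.mul_conj']
    push_cast
    rfl

theorem hasSum_taylorCoeff {h : ℂ → ℂ} (hh : DifferentiableOn ℂ h unitDisk) {z : ℂ}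
    (hz : z ∈ unitDisk) : HasSum (fun n => taylorCoeff h n * z ^ n) (h z) := by
  have := Complex.hasSum_taylorSeries_on_ball (c := 0) (r := 1) (by simpa [unitDisk] using hh)
    (by simpa [unitDisk] using hz)
  have e : ∀ n, taylorCoeff h n * z ^ n =
      ((n.factorial : ℂ)⁻¹ • (z - 0) ^ n • iteratedDeriv n h 0) := by
    intro n
    rw [taylorCoeff, sub_zero, smul_eq_mul, smul_eq_mul]
    ring
  simpa only [e] using this

theorem lintegral_circle_norm_sq {h : ℂ → ℂ} (hh : DifferentiableOn ℂ h unitDisk) {r : ℝ}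
    (hr : 0 ≤ r) (hr1 : r < 1) :
    ∫⁻ θ in Ioo (-Real.pi) Real.pi, ENNReal.ofReal (‖h (circleMap 0 r θ)‖ ^ 2) =
      ∑' n : ℕ, ENNReal.ofReal (2 * Real.pi * ‖taylorCoeff h n‖ ^ 2 * r ^ (2 * n)) := by
  set c : ℕ → ℂ := fun n => taylorCoeff h n * (r : ℂ) ^ n with hcdef
  have hc : Summable fun n => ‖c n‖ := by
    refine Summable.norm ?_
    exact (hasSum_taylorCoeff hh (mem_unitDisk.2 (by simpa [abs_of_nonneg hr] using hr1))).summable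
  have hval : ∀ θ : ℝ, h (circleMap 0 r θ) = ∑' n : ℕ, c n * Complex.exp (n * θ * Complex.I) := by
    intro θ
    rw [← (hasSum_taylorCoeff hh (circleMap_mem_unitDisk hr hr1 θ)).tsum_eq]
    congr 1
    ext n
    rw [circleMap_zero, mul_pow, ← Complex.exp_nat_mul, hcdef]
    ring_nf
  have hs := hasSum_parseval hc
  have hcont := continuous_trigSeries hc
  simp_rw [hval]
  rw [Measure.restrict_congr_set Ioo_ae_eq_Ioc, ← ofReal_integral_eq_lintegral_ofReal,
    ← intervalIntegral.integral_of_le (by linarith [Real.pi_pos]), ← hs.tsum_eq,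
    ENNReal.ofReal_tsum_of_nonneg (fun n => by positivity) hs.summable]
  · congr 1
    ext n
    congr 1
    simp only [hcdef, norm_mul, norm_pow, Complex.norm_real, Real.norm_eq_abs, abs_of_nonneg hr]
    ring
  · exact (Continuous.integrableOn_Icc (by fun_prop)).mono_set Ioc_subset_Icc_self
  · exact ae_of_all _ fun θ => by positivity

theorem ccoef_pos {β : ℝ} (hβ : 0 < β) (n : ℕ) : 0 < ccoef β n := by
  have := Real.Gamma_pos_of_pos hβ
  have : 0 < Real.Gamma (n + β) := Real.Gamma_pos_of_pos (by positivity)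
  unfold ccoef
  positivity

theorem ccoef_zero {β : ℝ} (hβ : 0 < β) : ccoef β 0 = 1 := by
  have := Real.Gamma_pos_of_pos hβ
  simp [ccoef, this.ne']

theorem taylorCoeff_zero (f : ℂ → ℂ) : taylorCoeff f 0 = f 0 := by
  simp [taylorCoeff]

theorem taylorCoeff_deriv (f : ℂ → ℂ) (n : ℕ) :
    taylorCoeff (deriv f) n = (n + 1) * taylorCoeff f (n + 1) := by
  have : (n.factorial : ℂ) ≠ 0 := by exact_mod_cast n.factorial_ne_zero
  have : (n : ℂ) + 1 ≠ 0 := by exact_mod_cast n.succ_ne_zero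
  simp only [taylorCoeff]
  rw [iteratedDeriv_succ', Nat.factorial_succ]
  push_cast
  field_simp

theorem differentiableOn_deriv_unitDisk {f : ℂ → ℂ} (hf : DifferentiableOn ℂ f unitDisk) :
    DifferentiableOn ℂ (deriv f) unitDisk :=
  hf.deriv isOpen_unitDisk

theorem lintegral_pow_mul_lintegral_tail {γ : ℝ} (hγ : 0 < γ) (n : ℕ) :
    ∫⁻ t in Ioo (0 : ℝ) 1, ENNReal.ofReal (t ^ (2 * n + 1)) *
        ∫⁻ r in Ioo t 1, ENNReal.ofReal ((1 - r ^ 2) ^ (γ - 1) / r) =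
      ENNReal.ofReal (n.factorial * Real.Gamma γ / (4 * (n + 1) * Real.Gamma (n + 1 + γ))) := by
  rw [← lintegral_triangle_swap (by fun_prop) (by fun_prop)]
  have : ∫⁻ r in Ioo (0 : ℝ) 1, ENNReal.ofReal ((1 - r ^ 2) ^ (γ - 1) / r) *
        ∫⁻ t in Ioo (0 : ℝ) r, ENNReal.ofReal (t ^ (2 * n + 1)) =
      ∫⁻ r in Ioo (0 : ℝ) 1, ENNReal.ofReal (1 / (2 * (n + 1))) *
        ENNReal.ofReal (r ^ (2 * n + 1) * (1 - r ^ 2) ^ (γ - 1)) := by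
    refine setLIntegral_congr_fun measurableSet_Ioo (fun r hr => ?_)
    have hr0 : 0 < r := hr.1
    have hpos : 0 < 1 - r ^ 2 := by nlinarith [hr.1, hr.2]
    rw [lintegral_pow_Ioo _ hr0.le, ← ENNReal.ofReal_mul (by positivity),
      ← ENNReal.ofReal_mul (by positivity)]
    congr 1
    push_cast
    field_simp
    ring
  have hG : 0 < Real.Gamma γ := Real.Gamma_pos_of_pos hγ
  have hG' : 0 < Real.Gamma (n + 1 + γ) := Real.Gamma_pos_of_pos (by positivity)
  rw [this, lintegral_const_mul _ (by fun_prop), lintegral_beta n hγ,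
    ← ENNReal.ofReal_mul (by positivity)]
  congr 1
  field_simp
  ring

theorem littlewoodPaley {α : ℝ} (hα : -2 < α) {f : ℂ → ℂ} (hf : DifferentiableOn ℂ f unitDisk) :
    A2normSq α f = ENNReal.ofReal (‖f 0‖ ^ 2) +
      (∫⁻ z in unitDisk, ENNReal.ofReal ((1 - ‖z‖ ^ 2) ^ (α + 2)) *
        kernelSeries (α + 2) (1 - ‖z‖ ^ 2) * ENNReal.ofReal (‖deriv f z‖ ^ 2)) /
          ENNReal.ofReal Real.pi := by
  have hγ : 0 < α + 2 := by linarith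
  have hdf := differentiableOn_deriv_unitDisk hf
  have hpi := Real.pi_pos
  rw [setLIntegral_unitDisk_radial_mul (c := fun z => ‖deriv f z‖ ^ 2) (by
      have := hdf.continuousOn
      fun_prop) (K := fun r => ENNReal.ofReal ((1 - r ^ 2) ^ (α + 2)) *
        kernelSeries (α + 2) (1 - r ^ 2))
      (Measurable.mul (by fun_prop) ((measurable_kernelSeries _).comp (by fun_prop)))]
  have h1 : ∀ r ∈ Ioo (0 : ℝ) 1, ENNReal.ofReal r * (ENNReal.ofReal ((1 - r ^ 2) ^ (α + 2)) *
        kernelSeries (α + 2) (1 - r ^ 2) *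
        ∫⁻ θ in Ioo (-Real.pi) Real.pi, ENNReal.ofReal (‖deriv f (circleMap 0 r θ)‖ ^ 2)) =
      ∑' n : ℕ, ENNReal.ofReal (4 * Real.pi * ((n + 1) ^ 2 * ‖taylorCoeff f (n + 1)‖ ^ 2)) *
        (ENNReal.ofReal (r ^ (2 * n + 1)) *
          ∫⁻ t in Ioo r 1, ENNReal.ofReal ((1 - t ^ 2) ^ (α + 2 - 1) / t)) := by
    intro r hr
    have hpos : 0 < 1 - r ^ 2 := by nlinarith [hr.1, hr.2]
    have hr0 : 0 < r := hr.1
    rw [lintegral_kernel hγ hr.1 hr.2, lintegral_circle_norm_sq hdf hr.1.le hr.2,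
      ← ENNReal.tsum_mul_left, ← ENNReal.tsum_mul_left]
    congr 1
    ext n
    have e1 : ENNReal.ofReal ((1 - r ^ 2) ^ (α + 2)) =
        ENNReal.ofReal 2 * ENNReal.ofReal ((1 - r ^ 2) ^ (α + 2) / 2) := by
      rw [← ENNReal.ofReal_mul (by norm_num)]
      congr 1
      ring
    have e2 : ENNReal.ofReal r * ENNReal.ofReal 2 *
        ENNReal.ofReal (2 * Real.pi * ‖taylorCoeff (deriv f) n‖ ^ 2 * r ^ (2 * n)) =
        ENNReal.ofReal (4 * Real.pi * ((n + 1) ^ 2 * ‖taylorCoeff f (n + 1)‖ ^ 2)) *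
          ENNReal.ofReal (r ^ (2 * n + 1)) := by
      rw [← ENNReal.ofReal_mul (by positivity), ← ENNReal.ofReal_mul (by positivity),
        ← ENNReal.ofReal_mul (by positivity), taylorCoeff_deriv]
      congr 1
      have : ‖(n : ℂ) + 1‖ = n + 1 := by
        rw [← Nat.cast_succ, Complex.norm_natCast]
        push_cast
        rfl
      rw [norm_mul, this]
      ring
    rw [e1, ← mul_assoc (ENNReal.ofReal (4 * Real.pi * _)), ← e2]
    ring
  rw [setLIntegral_congr_fun measurableSet_Ioo h1, lintegral_tsum]
  swap
  · intro n
    have : Measurable fun t : ℝ =>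
        ∫⁻ r in Ioo t 1, ENNReal.ofReal ((1 - r ^ 2) ^ (α + 2 - 1) / r) := by
      have hT : MeasurableSet {q : ℝ × ℝ | q.1 < q.2 ∧ q.2 < 1} :=
        (measurableSet_lt measurable_fst measurable_snd).inter
          (measurableSet_lt measurable_snd measurable_const)
      have hm : Measurable ({q : ℝ × ℝ | q.1 < q.2 ∧ q.2 < 1}.indicator
          fun q => ENNReal.ofReal ((1 - q.2 ^ 2) ^ (α + 2 - 1) / q.2)) :=
        Measurable.indicator (by fun_prop) hT
      convert! hm.lintegral_prod_right' (ν := volume) using 1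
      ext t
      rw [← lintegral_indicator measurableSet_Ioo]
      rfl
    exact (Measurable.const_mul (Measurable.mul (by fun_prop) this) _).aemeasurable
  have h2 : ∀ n : ℕ, ∫⁻ r in Ioo (0 : ℝ) 1,
      ENNReal.ofReal (4 * Real.pi * ((n + 1) ^ 2 * ‖taylorCoeff f (n + 1)‖ ^ 2)) *
        (ENNReal.ofReal (r ^ (2 * n + 1)) *
          ∫⁻ t in Ioo r 1, ENNReal.ofReal ((1 - t ^ 2) ^ (α + 2 - 1) / t)) =
      ENNReal.ofReal Real.pi *
        ENNReal.ofReal (‖taylorCoeff f (n + 1)‖ ^ 2 / ccoef (α + 2) (n + 1)) := by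
    intro n
    have hG : 0 < Real.Gamma (α + 2) := Real.Gamma_pos_of_pos hγ
    have hG' : 0 < Real.Gamma (n + 1 + (α + 2)) := Real.Gamma_pos_of_pos (by positivity)
    rw [lintegral_const_mul' _ _ ENNReal.ofReal_ne_top, lintegral_pow_mul_lintegral_tail hγ,
      ← ENNReal.ofReal_mul (by positivity), ← ENNReal.ofReal_mul hpi.le]
    congr 1
    rw [ccoef, Nat.factorial_succ]
    push_cast
    field_simp
  simp_rw [h2]
  rw [ENNReal.tsum_mul_left, mul_comm (ENNReal.ofReal Real.pi),
    ENNReal.mul_div_cancel_right (ENNReal.ofReal_pos.2 hpi).ne' ENNReal.ofReal_ne_top, A2normSq,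
    tsum_eq_zero_add' ENNReal.summable]
  simp [taylorCoeff_zero, ccoef_zero hγ]

theorem apIntPow_two {α : ℝ} (hα : -1 < α) {f : ℂ → ℂ} (hf : DifferentiableOn ℂ f unitDisk) :
    ApIntPow 2 α f = A2normSq α f := by
  have hpi := Real.pi_pos
  have hγ : 0 < α + 1 := by linarith
  have h0 : ∫⁻ z in unitDisk, ENNReal.ofReal ((1 - ‖z‖ ^ 2) ^ α * ‖f z‖ ^ (2 : ℝ)) =
      ∫⁻ z in unitDisk, ENNReal.ofReal ((1 - ‖z‖ ^ 2) ^ α) * ENNReal.ofReal (‖f z‖ ^ 2) := by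
    refine setLIntegral_congr_fun isOpen_unitDisk.measurableSet (fun z hz => ?_)
    have hz1 := mem_unitDisk.1 hz
    have : 0 ≤ 1 - ‖z‖ ^ 2 := by nlinarith [norm_nonneg z]
    rw [← ENNReal.ofReal_mul (by positivity), Real.rpow_two]
  rw [ApIntPow, h0, setLIntegral_unitDisk_radial_mul (c := fun z => ‖f z‖ ^ 2) (by
      have := hf.continuousOn
      fun_prop) (K := fun r => ENNReal.ofReal ((1 - r ^ 2) ^ α)) (by fun_prop)]
  have h1 : ∀ r ∈ Ioo (0 : ℝ) 1, ENNReal.ofReal r * (ENNReal.ofReal ((1 - r ^ 2) ^ α) *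
        ∫⁻ θ in Ioo (-Real.pi) Real.pi, ENNReal.ofReal (‖f (circleMap 0 r θ)‖ ^ 2)) =
      ∑' n : ℕ, ENNReal.ofReal (2 * Real.pi * ‖taylorCoeff f n‖ ^ 2) *
        ENNReal.ofReal (r ^ (2 * n + 1) * (1 - r ^ 2) ^ (α + 1 - 1)) := by
    intro r hr
    have hpos : 0 < 1 - r ^ 2 := by nlinarith [hr.1, hr.2]
    have hr0 : 0 < r := hr.1
    rw [lintegral_circle_norm_sq hf hr.1.le hr.2,
      ← ENNReal.tsum_mul_left, ← ENNReal.tsum_mul_left]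
    congr 1
    ext n
    rw [← ENNReal.ofReal_mul (by positivity), ← ENNReal.ofReal_mul (by positivity),
      ← ENNReal.ofReal_mul (by positivity), add_sub_cancel_right]
    congr 1
    ring
  rw [setLIntegral_congr_fun measurableSet_Ioo h1, lintegral_tsum (fun n => by fun_prop),
    ← ENNReal.tsum_mul_left, div_eq_mul_inv, ← ENNReal.tsum_mul_right, A2normSq]
  congr 1
  ext n
  have hG : 0 < Real.Gamma (α + 1) := Real.Gamma_pos_of_pos hγ
  have hG' : 0 < Real.Gamma (n + (α + 2)) := Real.Gamma_pos_of_pos (by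
    have : (0 : ℝ) ≤ n := n.cast_nonneg
    linarith)
  rw [lintegral_const_mul _ (by fun_prop), lintegral_beta n hγ,
    ← ENNReal.ofReal_mul (by positivity), ← ENNReal.ofReal_mul (by positivity),
    ← div_eq_mul_inv, ← ENNReal.ofReal_div_of_pos hpi]
  congr 1
  rw [ccoef, show (n : ℝ) + 1 + (α + 1) = n + (α + 2) by ring,
    show Real.Gamma (α + 2) = (α + 1) * Real.Gamma (α + 1) by
      rw [← Real.Gamma_add_one hγ.ne']; ring_nf]
  field_simp

/-- The real derivative of `w ↦ ‖w‖ ^ (p - 2) • w`. -/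
def normRpowSmulFDeriv (p : ℝ) (w : ℂ) : ℂ →L[ℝ] ℂ :=
  ‖w‖ ^ (p - 2) • ContinuousLinearMap.id ℝ ℂ +
    ((p - 2) * ‖w‖ ^ (p - 4)) • (innerSL ℝ w).smulRight w

theorem hasFDerivAt_norm_rpow_smul {p : ℝ} (hp : 2 < p) (w : ℂ) :
    HasFDerivAt (fun w : ℂ => ‖w‖ ^ (p - 2) • w) (normRpowSmulFDeriv p w) w := by
  rcases eq_or_ne w 0 with rfl | hw
  · have : normRpowSmulFDeriv p 0 = 0 := by
      ext <;> simp [normRpowSmulFDeriv, Real.zero_rpow (sub_pos.2 hp).ne']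
    rw [this, hasFDerivAt_iff_isLittleO_nhds_zero]
    simp only [zero_add, smul_zero, sub_zero, zero_apply]
    have h1 : Tendsto (fun h : ℂ => ‖h‖ ^ (p - 2)) (𝓝 0) (𝓝 0) := by
      have : ContinuousAt (fun h : ℂ => ‖h‖ ^ (p - 2)) 0 :=
        ContinuousAt.rpow_const continuous_norm.continuousAt (Or.inr (sub_pos.2 hp).le)
      simpa [ContinuousAt, Real.zero_rpow (sub_pos.2 hp).ne'] using this
    have := (Asymptotics.isLittleO_one_iff ℝ).2 h1
    simpa using this.smul_isBigO (Asymptotics.isBigO_refl (fun h : ℂ => h) (𝓝 0))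
  · have hn : 0 < ‖w‖ := norm_pos_iff.2 hw
    have h1 := ((hasStrictFDerivAt_norm_sq (F := ℂ) w).hasFDerivAt.rpow_const
      (p := (p - 2) / 2) (Or.inl (by positivity)))
    have h2 : (fun x : ℂ => (‖x‖ ^ 2) ^ ((p - 2) / 2)) = fun x : ℂ => ‖x‖ ^ (p - 2) := by
      ext x
      rw [← Real.rpow_natCast, ← Real.rpow_mul (norm_nonneg x)]
      congr 1
      push_cast
      ring
    rw [h2] at h1
    refine (h1.smul (hasFDerivAt_id w)).congr_fderiv ?_
    have h3 : (‖w‖ ^ 2) ^ ((p - 2) / 2 - 1) = ‖w‖ ^ (p - 4) := by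
      rw [← Real.rpow_natCast, ← Real.rpow_mul hn.le]
      congr 1
      push_cast
      ring
    have h4 : ‖w‖ ^ (2 * ((p - 2) / 2)) = ‖w‖ ^ (p - 2) := by ring_nf
    ext v
    simp only [normRpowSmulFDeriv, h3, add_apply,
      smul_apply, ContinuousLinearMap.smulRight_apply, id,
      ContinuousLinearMap.coe_id', smul_smul, smul_eq_mul, innerSL_apply_apply]
    congr 2
    simp
    ring

theorem inner_normRpowSmulFDeriv_add {p : ℝ} (hp : 2 < p) (w d : ℂ) :
    inner ℝ (normRpowSmulFDeriv p w d) d +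
      inner ℝ (normRpowSmulFDeriv p w (Complex.I * d)) (Complex.I * d) =
      p * ‖w‖ ^ (p - 2) * ‖d‖ ^ 2 := by
  have h1 : (inner ℝ w d) ^ 2 + (inner ℝ w (Complex.I * d)) ^ 2 = ‖w‖ ^ 2 * ‖d‖ ^ 2 := by
    simp only [Complex.inner, Complex.sq_norm, Complex.normSq_apply, Complex.mul_re,
      Complex.mul_im, Complex.conj_re, Complex.conj_im, Complex.I_re, Complex.I_im]
    ring
  have h2 : ‖w‖ ^ (p - 4) * (‖w‖ ^ 2 * ‖d‖ ^ 2) = ‖w‖ ^ (p - 2) * ‖d‖ ^ 2 := by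
    rcases eq_or_ne w 0 with rfl | hw
    · simp [Real.zero_rpow (sub_pos.2 hp).ne']
    · rw [← mul_assoc, ← Real.rpow_natCast, ← Real.rpow_add (norm_pos_iff.2 hw)]
      congr 2
      push_cast
      ring
  simp only [normRpowSmulFDeriv, add_apply,
      smul_apply, ContinuousLinearMap.smulRight_apply, id,
      ContinuousLinearMap.coe_id', innerSL_apply_apply, inner_add_left, real_inner_smul_left,
      real_inner_self_eq_norm_sq, norm_mul, Complex.norm_I, one_mul]
  linear_combination (p - 2) * ‖w‖ ^ (p - 4) * h1 + (p - 2) * h2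

/-- The derivative of `(r, θ) ↦ r e^{iθ}`. -/
def polarFDeriv (q : ℝ × ℝ) : ℝ × ℝ →L[ℝ] ℂ :=
  (ContinuousLinearMap.fst ℝ ℝ ℝ).smulRight (Complex.exp (q.2 * Complex.I)) +
    (ContinuousLinearMap.snd ℝ ℝ ℝ).smulRight (Complex.I * (q.1 * Complex.exp (q.2 * Complex.I)))

theorem hasFDerivAt_exp_snd (q : ℝ × ℝ) :
    HasFDerivAt (fun q : ℝ × ℝ => Complex.exp (q.2 * Complex.I))
      ((ContinuousLinearMap.snd ℝ ℝ ℝ).smulRight (Complex.I * Complex.exp (q.2 * Complex.I))) q := by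
  have h0 : HasFDerivAt (fun q : ℝ × ℝ => ((q.2 : ℝ) : ℂ))
      (Complex.ofRealCLM.comp (ContinuousLinearMap.snd ℝ ℝ ℝ)) q :=
    Complex.ofRealCLM.hasFDerivAt.comp q hasFDerivAt_snd
  refine ((h0.mul_const Complex.I).cexp).congr_fderiv ?_
  ext <;> simp [mul_comm]

theorem hasFDerivAt_polar (q : ℝ × ℝ) :
    HasFDerivAt (fun q : ℝ × ℝ => circleMap 0 q.1 q.2) (polarFDeriv q) q := by
  have h0 : HasFDerivAt (fun q : ℝ × ℝ => ((q.1 : ℝ) : ℂ))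
      (Complex.ofRealCLM.comp (ContinuousLinearMap.fst ℝ ℝ ℝ)) q :=
    Complex.ofRealCLM.hasFDerivAt.comp q hasFDerivAt_fst
  have := h0.mul (hasFDerivAt_exp_snd q)
  simp only [circleMap, zero_add]
  refine this.congr_fderiv ?_
  ext <;> simp [polarFDeriv, mul_comm, mul_left_comm]

theorem hasFDerivAt_comp_polar {h : ℂ → ℂ} (hh : DifferentiableOn ℂ h unitDisk) {q : ℝ × ℝ}
    (hq : circleMap 0 q.1 q.2 ∈ unitDisk) :
    HasFDerivAt (fun q : ℝ × ℝ => h (circleMap 0 q.1 q.2))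
      (deriv h (circleMap 0 q.1 q.2) • polarFDeriv q) q := by
  have h1 : HasDerivAt h (deriv h (circleMap 0 q.1 q.2)) (circleMap 0 q.1 q.2) :=
    (hh.differentiableAt (isOpen_unitDisk.mem_nhds hq)).hasDerivAt
  refine (h1.hasFDerivAt.restrictScalars ℝ |>.comp q (hasFDerivAt_polar q)).congr_fderiv ?_
  ext <;> simp [mul_comm]

theorem continuousOn_comp_polar {E : Type*} [TopologicalSpace E] {h : ℂ → E}
    (hh : ContinuousOn h unitDisk) {t : ℝ} (ht0 : 0 ≤ t) (ht1 : t < 1) (a b : ℝ) :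
    ContinuousOn (fun q : ℝ × ℝ => h (circleMap 0 q.1 q.2)) (uIcc 0 t ×ˢ uIcc a b) := by
  refine hh.comp (fun q _ => (hasFDerivAt_polar q).continuousAt.continuousWithinAt) ?_
  rintro ⟨r, θ⟩ ⟨hr, -⟩
  rw [uIcc_of_le ht0] at hr
  exact circleMap_mem_unitDisk hr.1 (hr.2.trans_lt ht1) θ

theorem continuous_norm_rpow_smul {p : ℝ} (hp : 2 < p) :
    Continuous fun w : ℂ => ‖w‖ ^ (p - 2) • w :=
  continuous_iff_continuousAt.2 fun w => (hasFDerivAt_norm_rpow_smul hp w).continuousAt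

theorem integral_circle_norm_rpow_sub {p : ℝ} (hp : 2 < p) {f : ℂ → ℂ}
    (hf : DifferentiableOn ℂ f unitDisk) {t : ℝ} (ht0 : 0 ≤ t) (ht1 : t < 1) :
    (∫ θ in (-Real.pi)..Real.pi, ‖f (circleMap 0 t θ)‖ ^ p) - 2 * Real.pi * ‖f 0‖ ^ p =
      ∫ r in (0 : ℝ)..t, ∫ θ in (-Real.pi)..Real.pi,
        p * inner ℝ (‖f (circleMap 0 r θ)‖ ^ (p - 2) • f (circleMap 0 r θ))
          (Complex.exp (θ * Complex.I) * deriv f (circleMap 0 r θ)) := by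
  have hmem : ∀ q : ℝ × ℝ, q ∈ Icc 0 t ×ˢ (univ : Set ℝ) → circleMap 0 q.1 q.2 ∈ unitDisk :=
    fun q hq => circleMap_mem_unitDisk hq.1.1 (hq.1.2.trans_lt ht1) _
  have hdf := differentiableOn_deriv_unitDisk hf
  have heval : ∀ q : ℝ × ℝ, ((p * ‖f (circleMap 0 q.1 q.2)‖ ^ (p - 2)) •
      innerSL ℝ (f (circleMap 0 q.1 q.2))).comp
        (deriv f (circleMap 0 q.1 q.2) • polarFDeriv q) (1, 0) + (0 : ℝ × ℝ →L[ℝ] ℝ) (0, 1) =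
      p * inner ℝ (‖f (circleMap 0 q.1 q.2)‖ ^ (p - 2) • f (circleMap 0 q.1 q.2))
        (Complex.exp (q.2 * Complex.I) * deriv f (circleMap 0 q.1 q.2)) := by
    intro q
    have : (deriv f (circleMap 0 q.1 q.2) • polarFDeriv q) (1, 0) =
        Complex.exp (q.2 * Complex.I) * deriv f (circleMap 0 q.1 q.2) := by
      simp [polarFDeriv, mul_comm]
    rw [ContinuousLinearMap.comp_apply, this, real_inner_smul_left, zero_apply, add_zero,
      smul_apply, innerSL_apply_apply, smul_eq_mul, mul_assoc]
  have key := integral2_divergence_prod_of_hasFDerivAt_off_countable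
    (fun q : ℝ × ℝ => ‖f (circleMap 0 q.1 q.2)‖ ^ p) (fun _ => (0 : ℝ))
    (fun q => ((p * ‖f (circleMap 0 q.1 q.2)‖ ^ (p - 2)) •
      innerSL ℝ (f (circleMap 0 q.1 q.2))).comp
        (deriv f (circleMap 0 q.1 q.2) • polarFDeriv q)) (fun _ => 0)
    0 (-Real.pi) t Real.pi ∅ countable_empty
    ((continuousOn_comp_polar hf.continuousOn ht0 ht1 _ _).norm.rpow_const
      fun x _ => Or.inr (by linarith)) continuousOn_const
    (by
      rintro q ⟨⟨hq, -⟩, -⟩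
      rw [min_eq_left ht0, max_eq_right ht0] at hq
      exact (hasFDerivAt_norm_rpow (f (circleMap 0 q.1 q.2)) (by linarith : 1 < p)).comp q
        (hasFDerivAt_comp_polar hf (hmem q ⟨Ioo_subset_Icc_self hq, mem_univ _⟩)))
    (fun q _ => hasFDerivAt_const _ _)
    (by
      refine ContinuousOn.integrableOn_compact (isCompact_uIcc.prod isCompact_uIcc) ?_
      have h1 := continuousOn_comp_polar ((continuous_norm_rpow_smul hp).comp_continuousOn
        hf.continuousOn) ht0 ht1 (-Real.pi) Real.pi
      have h2 := continuousOn_comp_polar hdf.continuousOn ht0 ht1 (-Real.pi) Real.pi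
      have h3 : ContinuousOn (fun q : ℝ × ℝ => Complex.exp (q.2 * Complex.I))
        (uIcc 0 t ×ˢ uIcc (-Real.pi) Real.pi) := by fun_prop
      refine (continuousOn_const.mul (h1.inner (𝕜 := ℝ) (h3.mul h2))).congr (f := fun q => p * _) ?_
      exact fun q _ => heval q)
  have heval' := fun r θ : ℝ => heval (r, θ)
  dsimp only at heval'
  simp_rw [heval'] at key
  simp only [intervalIntegral.integral_zero, sub_self, zero_add] at key
  have h0 : ∫ y in (-Real.pi)..Real.pi, ‖f (circleMap 0 0 y)‖ ^ p = 2 * Real.pi * ‖f 0‖ ^ p := by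
    simp only [circleMap_zero_radius, Function.const_apply, intervalIntegral.integral_const,
      smul_eq_mul]
    ring
  rw [h0] at key
  exact key.symm

theorem mul_integral_circle_inner {p : ℝ} (hp : 2 < p) {f : ℂ → ℂ}
    (hf : DifferentiableOn ℂ f unitDisk) {t : ℝ} (ht0 : 0 ≤ t) (ht1 : t < 1) :
    t * (∫ θ in (-Real.pi)..Real.pi,
        inner ℝ (‖f (circleMap 0 t θ)‖ ^ (p - 2) • f (circleMap 0 t θ))
          (Complex.exp (θ * Complex.I) * deriv f (circleMap 0 t θ))) =
      ∫ r in (0 : ℝ)..t, ∫ θ in (-Real.pi)..Real.pi,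
        r * (p * ‖f (circleMap 0 r θ)‖ ^ (p - 2) * ‖deriv f (circleMap 0 r θ)‖ ^ 2) := by
  have hmem : ∀ q : ℝ × ℝ, q ∈ Icc 0 t ×ˢ (univ : Set ℝ) → circleMap 0 q.1 q.2 ∈ unitDisk :=
    fun q hq => circleMap_mem_unitDisk hq.1.1 (hq.1.2.trans_lt ht1) _
  have hdf := differentiableOn_deriv_unitDisk hf
  set P : ℝ × ℝ → ℂ := fun q => circleMap 0 q.1 q.2 with hP
  set e : ℝ × ℝ → ℂ := fun q => Complex.exp (q.2 * Complex.I) with he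
  set Ψ : ℝ × ℝ → ℂ := fun q => ‖f (P q)‖ ^ (p - 2) • f (P q) with hΨ
  set Ψ' : ℝ × ℝ → ℝ × ℝ →L[ℝ] ℂ := fun q =>
    (normRpowSmulFDeriv p (f (P q))).comp (deriv f (P q) • polarFDeriv q) with hΨ'
  set d : ℝ × ℝ → ℂ := fun q => e q * deriv f (P q) with hd
  set d' : ℝ × ℝ → ℝ × ℝ →L[ℝ] ℂ := fun q =>
    e q • (deriv (deriv f) (P q) • polarFDeriv q) + deriv f (P q) •
      ((ContinuousLinearMap.snd ℝ ℝ ℝ).smulRight (Complex.I * e q)) with hd'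
  have hΨd : ∀ q ∈ Icc 0 t ×ˢ (univ : Set ℝ), HasFDerivAt Ψ (Ψ' q) q := fun q hq =>
    HasFDerivAt.comp (g := fun w : ℂ => ‖w‖ ^ (p - 2) • w) q
      (hasFDerivAt_norm_rpow_smul hp (f (P q))) (hasFDerivAt_comp_polar hf (hmem q hq))
  have hdd : ∀ q ∈ Icc 0 t ×ˢ (univ : Set ℝ), HasFDerivAt d (d' q) q := fun q hq =>
    (hasFDerivAt_exp_snd q).mul (hasFDerivAt_comp_polar hdf (hmem q hq))
  have hrd : ∀ q ∈ Icc 0 t ×ˢ (univ : Set ℝ), HasFDerivAt (fun q => q.1 • d q)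
      (q.1 • d' q + (ContinuousLinearMap.fst ℝ ℝ ℝ).smulRight (d q)) q := fun q hq =>
    hasFDerivAt_fst.smul (hdd q hq)
  have hid : ∀ q ∈ Icc 0 t ×ˢ (univ : Set ℝ), HasFDerivAt (fun q => Complex.I * d q)
      (Complex.I • d' q) q := fun q hq => (hdd q hq).const_mul Complex.I
  have hsub : uIcc 0 t ×ˢ uIcc (-Real.pi) Real.pi ⊆ Icc 0 t ×ˢ (univ : Set ℝ) := by
    rw [uIcc_of_le ht0]
    exact prod_mono_right (subset_univ _)
  have hsub' : Ioo (min 0 t) (max 0 t) ×ˢ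
      Ioo (min (-Real.pi) Real.pi) (max (-Real.pi) Real.pi) \ ∅ ⊆ Icc 0 t ×ˢ (univ : Set ℝ) := by
    rw [min_eq_left ht0, max_eq_right ht0]
    exact sdiff_subset.trans (prod_mono Ioo_subset_Icc_self (subset_univ _))
  have hdiv : ∀ q : ℝ × ℝ,
      ((fderivInnerCLM ℝ (Ψ q, q.1 • d q)).comp ((Ψ' q).prod
        (q.1 • d' q + (ContinuousLinearMap.fst ℝ ℝ ℝ).smulRight (d q)))) (1, 0) +
      ((fderivInnerCLM ℝ (Ψ q, Complex.I * d q)).comp ((Ψ' q).prod (Complex.I • d' q))) (0, 1) =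
      q.1 * (p * ‖f (P q)‖ ^ (p - 2) * ‖deriv f (P q)‖ ^ 2) := by
    intro q
    have h1 := inner_normRpowSmulFDeriv_add hp (f (P q)) (d q)
    have h2 : ‖d q‖ = ‖deriv f (P q)‖ := by
      simp only [hd, he, norm_mul, Complex.norm_exp_ofReal_mul_I, one_mul]
    have e1 : Ψ' q (1, 0) = normRpowSmulFDeriv p (f (P q)) (d q) := by
      simp [hΨ', polarFDeriv, hd, he, mul_comm]
    have e2 : Ψ' q (0, 1) = q.1 • normRpowSmulFDeriv p (f (P q)) (Complex.I * d q) := by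
      rw [← map_smul]
      simp [hΨ', polarFDeriv, hd, he, mul_comm, mul_left_comm, mul_assoc]
    have e3 : (q.1 • d' q) (1, 0) + (Complex.I • d' q) (0, 1) = - d q := by
      simp only [hd', polarFDeriv, hd, he]
      simp
      ring_nf
      simp
    simp only [ContinuousLinearMap.comp_apply, fderivInnerCLM_apply,
      ContinuousLinearMap.prod_apply, e1, e2, add_apply, ContinuousLinearMap.smulRight_apply,
      ContinuousLinearMap.coe_fst', one_smul, inner_add_right, real_inner_smul_left,
      real_inner_smul_right]
    have e4 : inner ℝ (Ψ q) ((q.1 • d' q) (1, 0)) + inner ℝ (Ψ q) ((Complex.I • d' q) (0, 1)) =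
      - inner ℝ (Ψ q) (d q) := by rw [← inner_add_right, e3, inner_neg_right]
    rw [h2] at h1
    linear_combination q.1 * h1 + e4
  have key := integral2_divergence_prod_of_hasFDerivAt_off_countable
    (fun q : ℝ × ℝ => (inner ℝ (Ψ q) (q.1 • d q) : ℝ))
    (fun q => (inner ℝ (Ψ q) (Complex.I * d q) : ℝ)) _ _ 0 (-Real.pi) t Real.pi ∅ countable_empty
    (fun q hq => ((hΨd q (hsub hq)).inner ℝ (hrd q (hsub hq))).continuousAt.continuousWithinAt)
    (fun q hq => ((hΨd q (hsub hq)).inner ℝ (hid q (hsub hq))).continuousAt.continuousWithinAt)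
    (fun q hq => (hΨd q (hsub' hq)).inner ℝ (hrd q (hsub' hq)))
    (fun q hq => (hΨd q (hsub' hq)).inner ℝ (hid q (hsub' hq)))
    (by
      refine ContinuousOn.integrableOn_compact (isCompact_uIcc.prod isCompact_uIcc) ?_
      simp_rw [hdiv]
      refine continuousOn_fst.mul ((continuousOn_const.mul ?_).mul ?_)
      · exact (continuousOn_comp_polar hf.continuousOn ht0 ht1 _ _).norm.rpow_const
          fun x _ => Or.inr (by linarith)
      · exact (continuousOn_comp_polar hdf.continuousOn ht0 ht1 _ _).norm.pow 2)
  simp_rw [hdiv] at key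
  rw [key]
  have hper : ∀ r : ℝ, (inner ℝ (Ψ (r, Real.pi)) (Complex.I * d (r, Real.pi)) : ℝ) =
      inner ℝ (Ψ (r, -Real.pi)) (Complex.I * d (r, -Real.pi)) := by
    intro r
    have : Complex.exp (-(Real.pi * Complex.I)) = Complex.exp (Real.pi * Complex.I) := by
      rw [Complex.exp_neg, Complex.exp_pi_mul_I]
      norm_num
    simp [hΨ, hd, hP, he, circleMap, this]
  simp_rw [hper, sub_self, zero_add, real_inner_smul_right, zero_mul,
    intervalIntegral.integral_zero, sub_zero, intervalIntegral.integral_const_mul]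
  rfl

theorem ofReal_intervalIntegral_of_nonneg {g : ℝ → ℝ} {a b : ℝ} (hab : a ≤ b)
    (hg : IntegrableOn g (Ioc a b)) (h0 : ∀ x ∈ Ioo a b, 0 ≤ g x) :
    ENNReal.ofReal (∫ x in a..b, g x) = ∫⁻ x in Ioo a b, ENNReal.ofReal (g x) := by
  rw [intervalIntegral.integral_of_le hab, integral_Ioc_eq_integral_Ioo,
    ofReal_integral_eq_lintegral_ofReal (hg.mono_set Ioo_subset_Ioc_self)]
  exact (ae_restrict_iff' measurableSet_Ioo).2 (Eventually.of_forall h0)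

theorem integrableOn_intervalIntegral {F : ℝ × ℝ → ℝ} {a b c d : ℝ} (hab : a ≤ b) (hcd : c ≤ d)
    (hF : ContinuousOn F (uIcc a b ×ˢ uIcc c d)) :
    IntegrableOn (fun x => ∫ y in c..d, F (x, y)) (Ioc a b) := by
  have h1 : IntegrableOn F (uIcc a b ×ˢ uIcc c d) :=
    hF.integrableOn_compact (isCompact_uIcc.prod isCompact_uIcc)
  have h2 : IntegrableOn F (Ioc a b ×ˢ Ioc c d) := h1.mono_set (by
    rw [uIcc_of_le hab, uIcc_of_le hcd]
    exact prod_mono Ioc_subset_Icc_self Ioc_subset_Icc_self)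
  simp_rw [intervalIntegral.integral_of_le hcd]
  rw [IntegrableOn, Measure.volume_eq_prod, ← Measure.prod_restrict] at h2
  exact h2.integral_prod_left

theorem ofReal_intervalIntegral_intervalIntegral {F : ℝ × ℝ → ℝ} {a b c d : ℝ} (hab : a ≤ b)
    (hcd : c ≤ d) (hF : ContinuousOn F (uIcc a b ×ˢ uIcc c d))
    (h0 : ∀ x ∈ Icc a b, ∀ y, 0 ≤ F (x, y)) :
    ENNReal.ofReal (∫ x in a..b, ∫ y in c..d, F (x, y)) =
      ∫⁻ x in Ioo a b, ∫⁻ y in Ioo c d, ENNReal.ofReal (F (x, y)) := by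
  rw [ofReal_intervalIntegral_of_nonneg hab (integrableOn_intervalIntegral hab hcd hF)
    (fun x hx => intervalIntegral.integral_nonneg hcd fun y _ => h0 x (Ioo_subset_Icc_self hx) y)]
  refine setLIntegral_congr_fun measurableSet_Ioo fun x hx => ?_
  refine ofReal_intervalIntegral_of_nonneg hcd ?_ fun y _ => h0 x (Ioo_subset_Icc_self hx) y
  have : ContinuousOn (fun y => F (x, y)) (Icc c d) :=
    hF.comp (by fun_prop) fun y hy => ⟨by
      rw [uIcc_of_le hab]; exact Ioo_subset_Icc_self hx, by rwa [uIcc_of_le hcd]⟩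
  exact (this.integrableOn_compact isCompact_Icc).mono_set Ioc_subset_Icc_self

theorem lintegral_circle_norm_rpow {p : ℝ} (hp : 2 < p) {f : ℂ → ℂ}
    (hf : DifferentiableOn ℂ f unitDisk) {r : ℝ} (hr0 : 0 ≤ r) (hr1 : r < 1) :
    ∫⁻ θ in Ioo (-Real.pi) Real.pi, ENNReal.ofReal (‖f (circleMap 0 r θ)‖ ^ p) =
      ENNReal.ofReal (2 * Real.pi * ‖f 0‖ ^ p) +
        ∫⁻ t in Ioo 0 r, ENNReal.ofReal (p ^ 2 / t) * ∫⁻ ρ in Ioo 0 t, ENNReal.ofReal ρ *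
          ∫⁻ θ in Ioo (-Real.pi) Real.pi, ENNReal.ofReal
            (‖deriv f (circleMap 0 ρ θ)‖ ^ 2 * ‖f (circleMap 0 ρ θ)‖ ^ (p - 2)) := by
  have hpi : -Real.pi ≤ Real.pi := by linarith [Real.pi_pos]
  have hdf := differentiableOn_deriv_unitDisk hf
  have hp0 : 0 < p := by linarith
  set W : ℝ → ℝ := fun t => ∫ θ in (-Real.pi)..Real.pi,
        inner ℝ (‖f (circleMap 0 t θ)‖ ^ (p - 2) • f (circleMap 0 t θ))
          (Complex.exp (θ * Complex.I) * deriv f (circleMap 0 t θ)) with hW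
  have hWt : ∀ t ∈ Ioo 0 r, ENNReal.ofReal (t * W t) = ENNReal.ofReal p * ∫⁻ ρ in Ioo 0 t,
      ENNReal.ofReal ρ * ∫⁻ θ in Ioo (-Real.pi) Real.pi, ENNReal.ofReal
            (‖deriv f (circleMap 0 ρ θ)‖ ^ 2 * ‖f (circleMap 0 ρ θ)‖ ^ (p - 2)) := by
    intro t ht
    have ht1 := ht.2.trans hr1
    rw [hW, mul_integral_circle_inner hp hf ht.1.le ht1, ofReal_intervalIntegral_intervalIntegral
      (F := fun q => q.1 * (p * ‖f (circleMap 0 q.1 q.2)‖ ^ (p - 2) *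
        ‖deriv f (circleMap 0 q.1 q.2)‖ ^ 2)) ht.1.le hpi,
      ← lintegral_const_mul' _ _ ENNReal.ofReal_ne_top]
    · refine setLIntegral_congr_fun measurableSet_Ioo fun ρ hρ => ?_
      rw [← mul_assoc, ← ENNReal.ofReal_mul hp0.le, ← lintegral_const_mul' _ _ ENNReal.ofReal_ne_top]
      refine lintegral_congr fun θ => ?_
      rw [← ENNReal.ofReal_mul (mul_nonneg hp0.le hρ.1.le)]
      congr 1
      ring
    · refine continuousOn_fst.mul ((continuousOn_const.mul ?_).mul ?_)
      · exact (continuousOn_comp_polar hf.continuousOn ht.1.le ht1 _ _).norm.rpow_const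
          fun x _ => Or.inr (by linarith)
      · exact (continuousOn_comp_polar hdf.continuousOn ht.1.le ht1 _ _).norm.pow 2
    · intro x hx y
      have := hx.1
      positivity
  have hW0 : ∀ t ∈ Ioo 0 r, 0 ≤ W t := by
    intro t ht
    have : 0 ≤ t * W t := by
      rw [hW, mul_integral_circle_inner hp hf ht.1.le (ht.2.trans hr1)]
      refine intervalIntegral.integral_nonneg ht.1.le fun x hx =>
        intervalIntegral.integral_nonneg hpi fun y _ => ?_
      have := hx.1
      positivity
    exact nonneg_of_mul_nonneg_right this ht.1
  have h1 := integral_circle_norm_rpow_sub hp hf hr0 hr1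
  simp_rw [intervalIntegral.integral_const_mul] at h1
  have h2 : ∫⁻ θ in Ioo (-Real.pi) Real.pi, ENNReal.ofReal (‖f (circleMap 0 r θ)‖ ^ p) =
      ENNReal.ofReal (∫ θ in (-Real.pi)..Real.pi, ‖f (circleMap 0 r θ)‖ ^ p) := by
    rw [ofReal_intervalIntegral_of_nonneg hpi ?_ fun θ _ => by positivity]
    have : Continuous fun θ : ℝ => f (circleMap 0 r θ) :=
      hf.continuousOn.comp_continuous (continuous_circleMap 0 r)
        fun θ => circleMap_mem_unitDisk hr0 hr1 θ
    exact ((this.norm.rpow_const fun x => Or.inr hp0.le).integrableOn_Icc).mono_set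
      Ioc_subset_Icc_self
  have hWi : IntegrableOn W (Ioc 0 r) := by
    refine integrableOn_intervalIntegral (F := fun q : ℝ × ℝ =>
      inner ℝ (‖f (circleMap 0 q.1 q.2)‖ ^ (p - 2) • f (circleMap 0 q.1 q.2))
          (Complex.exp (q.2 * Complex.I) * deriv f (circleMap 0 q.1 q.2))) hr0 hpi ?_
    exact (continuousOn_comp_polar ((continuous_norm_rpow_smul hp).comp_continuousOn
        hf.continuousOn) hr0 hr1 _ _).inner (𝕜 := ℝ) ((by fun_prop : Continuous fun q : ℝ × ℝ =>
          Complex.exp (q.2 * Complex.I)).continuousOn.mul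
        (continuousOn_comp_polar hdf.continuousOn hr0 hr1 _ _))
  rw [h2, sub_eq_iff_eq_add'.1 h1, ENNReal.ofReal_add (by positivity)
    (mul_nonneg hp0.le (intervalIntegral.integral_nonneg_of_ae_restrict hr0 ?_)),
    ENNReal.ofReal_mul hp0.le, ofReal_intervalIntegral_of_nonneg hr0 hWi hW0,
    ← lintegral_const_mul' _ _ ENNReal.ofReal_ne_top]
  · congr 1
    refine setLIntegral_congr_fun measurableSet_Ioo fun t ht => ?_
    have ht0 := ht.1
    have : ENNReal.ofReal (p ^ 2 / t) = ENNReal.ofReal (p / t) * ENNReal.ofReal p := by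
      rw [← ENNReal.ofReal_mul (by positivity)]
      congr 1
      ring
    rw [this, mul_assoc, ← hWt t ht, ← ENNReal.ofReal_mul hp0.le,
      ← ENNReal.ofReal_mul (by positivity : 0 ≤ p / t)]
    congr 1
    field_simp
  · rw [← Measure.restrict_congr_set Ioo_ae_eq_Icc]
    exact (ae_restrict_iff' measurableSet_Ioo).2 (Eventually.of_forall hW0)

theorem hardyStein {p b : ℝ} (hp : 2 < p) (hb : -1 < b) {f : ℂ → ℂ}
    (hf : DifferentiableOn ℂ f unitDisk) :
    ApIntPow p b f = ENNReal.ofReal (‖f 0‖ ^ p) +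
      ENNReal.ofReal (p ^ 2 / 4) * (∫⁻ z in unitDisk, ENNReal.ofReal ((1 - ‖z‖ ^ 2) ^ (b + 2)) *
        kernelSeries (b + 2) (1 - ‖z‖ ^ 2) * ENNReal.ofReal (‖deriv f z‖ ^ 2 * ‖f z‖ ^ (p - 2))) /
          ENNReal.ofReal Real.pi := by
  have hpi := Real.pi_pos
  have hdf := differentiableOn_deriv_unitDisk hf
  have hb1 : 0 < b + 1 := by linarith
  have hc : 0 < b + 2 := by linarith
  have hcont : ContinuousOn (fun z => ‖deriv f z‖ ^ 2 * ‖f z‖ ^ (p - 2)) unitDisk :=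
    (hdf.continuousOn.norm.pow 2).mul
      (hf.continuousOn.norm.rpow_const fun x _ => Or.inr (by linarith))
  have hcont' : ContinuousOn (fun z => ‖f z‖ ^ p) unitDisk :=
    hf.continuousOn.norm.rpow_const fun x _ => Or.inr (by linarith)
  set J : ℝ → ℝ≥0∞ := fun ρ => ∫⁻ θ in Ioo (-Real.pi) Real.pi, ENNReal.ofReal
    (unitDisk.indicator (fun z => ‖deriv f z‖ ^ 2 * ‖f z‖ ^ (p - 2)) (circleMap 0 ρ θ)) with hJ
  have hJm : Measurable J := by
    classical
    have h1 : Measurable (unitDisk.indicator fun z => ‖deriv f z‖ ^ 2 * ‖f z‖ ^ (p - 2)) := by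
      rw [← piecewise_eq_indicator]
      exact hcont.measurable_piecewise continuousOn_const isOpen_unitDisk.measurableSet
    have h2 : Measurable fun q : ℝ × ℝ => circleMap 0 q.1 q.2 := by
      unfold circleMap
      fun_prop
    exact ((h1.comp h2).ennreal_ofReal).lintegral_prod_right'
  have hJe : ∀ ρ ∈ Ioo (0 : ℝ) 1, ∫⁻ θ in Ioo (-Real.pi) Real.pi, ENNReal.ofReal
      (‖deriv f (circleMap 0 ρ θ)‖ ^ 2 * ‖f (circleMap 0 ρ θ)‖ ^ (p - 2)) = J ρ := by
    intro ρ hρ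
    refine lintegral_congr fun θ => ?_
    rw [indicator_of_mem (circleMap_mem_unitDisk hρ.1.le hρ.2 θ)]
  set V : ℝ → ℝ≥0∞ := fun t => ∫⁻ ρ in Ioo 0 t, ENNReal.ofReal ρ * J ρ with hV
  have hVm : Measurable V := by
    refine Monotone.measurable fun s t hst => ?_
    exact lintegral_mono_set (Ioo_subset_Ioo_right hst)
  have e0 : ∫⁻ z in unitDisk, ENNReal.ofReal ((1 - ‖z‖ ^ 2) ^ b * ‖f z‖ ^ p) =
      ∫⁻ z in unitDisk, ENNReal.ofReal ((1 - ‖z‖ ^ 2) ^ b) * ENNReal.ofReal (‖f z‖ ^ p) := by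
    refine setLIntegral_congr_fun isOpen_unitDisk.measurableSet fun z hz => ?_
    have : 0 ≤ 1 - ‖z‖ ^ 2 := by nlinarith [norm_nonneg z, mem_unitDisk.1 hz]
    exact ENNReal.ofReal_mul (by positivity)
  have e1 : ∀ r ∈ Ioo (0 : ℝ) 1, ENNReal.ofReal r * (ENNReal.ofReal ((1 - r ^ 2) ^ b) *
      ∫⁻ θ in Ioo (-Real.pi) Real.pi, ENNReal.ofReal (‖f (circleMap 0 r θ)‖ ^ p)) =
      ENNReal.ofReal (r * (1 - r ^ 2) ^ (b + 1 - 1)) * ENNReal.ofReal (2 * Real.pi * ‖f 0‖ ^ p) +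
      ENNReal.ofReal (r * (1 - r ^ 2) ^ (b + 1 - 1)) *
        ∫⁻ t in Ioo 0 r, ENNReal.ofReal (p ^ 2 / t) * V t := by
    intro r hr
    rw [lintegral_circle_norm_rpow hp hf hr.1.le hr.2, ← mul_assoc, ← ENNReal.ofReal_mul hr.1.le,
      add_sub_cancel_right, mul_add]
    congr 2
    refine setLIntegral_congr_fun measurableSet_Ioo fun t ht => ?_
    change _ = ENNReal.ofReal (p ^ 2 / t) * ∫⁻ ρ in Ioo 0 t, ENNReal.ofReal ρ * J ρ
    congr 1
    refine setLIntegral_congr_fun measurableSet_Ioo fun ρ hρ => ?_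
    rw [hJe ρ ⟨hρ.1, hρ.2.trans (ht.2.trans hr.2)⟩]
  have e2 : ∀ t ∈ Ioo (0 : ℝ) 1, ENNReal.ofReal (p ^ 2 / t) * V t *
      ∫⁻ r in Ioo t 1, ENNReal.ofReal (r * (1 - r ^ 2) ^ (b + 1 - 1)) =
      ENNReal.ofReal (p ^ 2 / (2 * (b + 1))) *
        (ENNReal.ofReal ((1 - t ^ 2) ^ (b + 2 - 1) / t) * V t) := by
    intro t ht
    have ht0 := ht.1
    have : 0 < 1 - t ^ 2 := by nlinarith [ht.1, ht.2]
    rw [lintegral_mul_one_sub_sq_rpow hb1 ht.1.le ht.2.le, mul_right_comm,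
      ← ENNReal.ofReal_mul (by positivity), ← mul_assoc, ← ENNReal.ofReal_mul (by positivity),
      show b + 2 - 1 = b + 1 by ring]
    congr 2
    field_simp
  have e3 : ∀ ρ ∈ Ioo (0 : ℝ) 1, ENNReal.ofReal ρ * J ρ *
      ∫⁻ t in Ioo ρ 1, ENNReal.ofReal ((1 - t ^ 2) ^ (b + 2 - 1) / t) =
      ENNReal.ofReal (1 / 2) * (ENNReal.ofReal ρ * (ENNReal.ofReal ((1 - ρ ^ 2) ^ (b + 2)) *
        kernelSeries (b + 2) (1 - ρ ^ 2) * ∫⁻ θ in Ioo (-Real.pi) Real.pi, ENNReal.ofReal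
          (‖deriv f (circleMap 0 ρ θ)‖ ^ 2 * ‖f (circleMap 0 ρ θ)‖ ^ (p - 2)))) := by
    intro ρ hρ
    rw [lintegral_kernel hc hρ.1 hρ.2, hJe ρ hρ, div_eq_mul_one_div _ (2 : ℝ),
      ENNReal.ofReal_mul' (by norm_num)]
    ring
  have h0 := lintegral_mul_one_sub_sq_rpow hb1 le_rfl zero_le_one
  rw [ApIntPow, e0, setLIntegral_unitDisk_radial_mul hcont'
      (K := fun r => ENNReal.ofReal ((1 - r ^ 2) ^ b)) (by fun_prop),
    setLIntegral_unitDisk_radial_mul hcont (K := fun r => ENNReal.ofReal ((1 - r ^ 2) ^ (b + 2)) *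
        kernelSeries (b + 2) (1 - r ^ 2))
      (Measurable.mul (by fun_prop) ((measurable_kernelSeries _).comp (by fun_prop))),
    setLIntegral_congr_fun measurableSet_Ioo e1, lintegral_add_left (by fun_prop),
    lintegral_mul_const _ (by fun_prop), h0,
    lintegral_triangle_swap (u := fun t => ENNReal.ofReal (p ^ 2 / t) * V t) (by fun_prop)
      (by fun_prop),
    setLIntegral_congr_fun measurableSet_Ioo e2, lintegral_const_mul' _ _ ENNReal.ofReal_ne_top,
    lintegral_triangle_swap (by fun_prop) (by fun_prop),
    setLIntegral_congr_fun measurableSet_Ioo e3, lintegral_const_mul' _ _ ENNReal.ofReal_ne_top,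
    mul_add, ENNReal.add_div]
  congr 1
  · rw [← ENNReal.ofReal_mul (by positivity), ← ENNReal.ofReal_mul (by positivity),
      ← ENNReal.ofReal_div_of_pos hpi]
    congr 1
    simp
    field_simp
  · rw [← mul_assoc, ← mul_assoc, ← ENNReal.ofReal_mul (by positivity),
      ← ENNReal.ofReal_mul (by positivity)]
    congr 3
    field_simp
    norm_num

theorem kernelSeries_eq_add {c y : ℝ} (hy : 0 ≤ y) :
    kernelSeries c y = ENNReal.ofReal (1 / c) + ENNReal.ofReal y * kernelSeries (c + 1) y := by
  rw [kernelSeries, tsum_eq_zero_add' ENNReal.summable, kernelSeries, ← ENNReal.tsum_mul_left]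
  congr 1
  · simp
  · refine tsum_congr fun k => ?_
    rw [← ENNReal.ofReal_mul hy]
    congr 1
    push_cast
    rw [pow_succ, show c + ((k : ℝ) + 1) = c + 1 + k by ring]
    ring

theorem ofReal_one_div_le_kernelSeries (c y : ℝ) :
    ENNReal.ofReal (1 / c) ≤ kernelSeries c y := by
  have := ENNReal.le_tsum (f := fun k : ℕ => ENNReal.ofReal (y ^ k / (c + k))) 0
  simpa [kernelSeries] using this

theorem one_sub_norm_sq_nonneg {z : ℂ} (hz : z ∈ unitDisk) : 0 ≤ 1 - ‖z‖ ^ 2 := by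
  nlinarith [norm_nonneg z, mem_unitDisk.1 hz]

theorem one_sub_norm_sq_pos {z : ℂ} (hz : z ∈ unitDisk) : 0 < 1 - ‖z‖ ^ 2 := by
  nlinarith [norm_nonneg z, mem_unitDisk.1 hz]

theorem ffun_eq {α : ℝ} (hα : -1 ≤ α) (p : ℝ) (f : ℂ → ℂ) :
    Ffun α p f = ENNReal.ofReal (‖f 0‖ ^ p) + ENNReal.ofReal (p / 2) *
      (∫⁻ z in unitDisk, ENNReal.ofReal ((1 - ‖z‖ ^ 2) ^ (p / 2 * (α + 2))) *
        kernelSeries (α + 2) (1 - ‖z‖ ^ 2) * ENNReal.ofReal (‖deriv f z‖ ^ 2 * ‖f z‖ ^ (p - 2))) /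
          ENNReal.ofReal Real.pi := by
  rw [Ffun]
  congr 3
  refine setLIntegral_congr_fun isOpen_unitDisk.measurableSet fun z hz => ?_
  rw [hinner_eq_kernelSeries (by linarith) hz, ENNReal.ofReal_mul (by positivity),
    show p * (α + 2) / 2 = p / 2 * (α + 2) by ring]
  ring

theorem ffun_le_apIntPow {α p : ℝ} (hα : -1 ≤ α) (hp : 2 < p) {f : ℂ → ℂ}
    (hf : DifferentiableOn ℂ f unitDisk) :
    Ffun α p f ≤ ApIntPow p (p / 2 * (α + 2) - 2) f := by
  rw [ffun_eq hα, hardyStein hp (by nlinarith) hf, sub_add_cancel]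
  gcongr _ + ?_ / _
  rw [← lintegral_const_mul' _ _ ENNReal.ofReal_ne_top,
    ← lintegral_const_mul' _ _ ENNReal.ofReal_ne_top]
  refine setLIntegral_mono' isOpen_unitDisk.measurableSet fun z hz => ?_
  have hy := one_sub_norm_sq_nonneg hz
  have h : ENNReal.ofReal (p / 2) * kernelSeries (α + 2) (1 - ‖z‖ ^ 2) ≤
      ENNReal.ofReal (p ^ 2 / 4) * kernelSeries (p / 2 * (α + 2)) (1 - ‖z‖ ^ 2) := by
    rw [kernelSeries, kernelSeries, ← ENNReal.tsum_mul_left, ← ENNReal.tsum_mul_left]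
    refine ENNReal.tsum_le_tsum fun k => ?_
    rw [← ENNReal.ofReal_mul (by positivity), ← ENNReal.ofReal_mul (by positivity)]
    refine ENNReal.ofReal_le_ofReal ?_
    have hk : (0 : ℝ) ≤ k := k.cast_nonneg
    rw [mul_div_assoc', mul_div_assoc', div_le_div_iff₀ (by nlinarith) (by nlinarith)]
    have : 0 ≤ (1 - ‖z‖ ^ 2) ^ k * (p / 2 * k * (p / 2 - 1)) := by
      have : 0 ≤ p / 2 - 1 := by linarith
      positivity
    nlinarith
  calc _ = ENNReal.ofReal (p / 2) * kernelSeries (α + 2) (1 - ‖z‖ ^ 2) *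
        (ENNReal.ofReal ((1 - ‖z‖ ^ 2) ^ (p / 2 * (α + 2))) *
          ENNReal.ofReal (‖deriv f z‖ ^ 2 * ‖f z‖ ^ (p - 2))) := by ring
    _ ≤ ENNReal.ofReal (p ^ 2 / 4) * kernelSeries (p / 2 * (α + 2)) (1 - ‖z‖ ^ 2) *
        (ENNReal.ofReal ((1 - ‖z‖ ^ 2) ^ (p / 2 * (α + 2))) *
          ENNReal.ofReal (‖deriv f z‖ ^ 2 * ‖f z‖ ^ (p - 2))) := by gcongr
    _ = _ := by ring

theorem apIntPow_le_ffun_add {α p : ℝ} (hα : -1 ≤ α) (hp : 2 < p) {f : ℂ → ℂ}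
    (hf : DifferentiableOn ℂ f unitDisk) :
    ApIntPow p (p / 2 * (α + 2) - 2) f ≤ Ffun α p f + ApIntPow p (p / 2 * (α + 2) - 1) f := by
  have hγ : 0 < α + 2 := by linarith
  have hcont : ContinuousOn (fun z => ‖deriv f z‖ ^ 2 * ‖f z‖ ^ (p - 2)) unitDisk :=
    ((differentiableOn_deriv_unitDisk hf).continuousOn.norm.pow 2).mul
      (hf.continuousOn.norm.rpow_const fun x _ => Or.inr (by linarith))
  have hm : AEMeasurable (fun z => ENNReal.ofReal (p / 2) *
      (ENNReal.ofReal ((1 - ‖z‖ ^ 2) ^ (p / 2 * (α + 2))) *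
        kernelSeries (α + 2) (1 - ‖z‖ ^ 2) * ENNReal.ofReal (‖deriv f z‖ ^ 2 * ‖f z‖ ^ (p - 2))))
      (volume.restrict unitDisk) := by
    have h1 := hcont.aemeasurable (μ := volume) isOpen_unitDisk.measurableSet
    have h2 := (measurable_kernelSeries (α + 2)).comp
      (by fun_prop : Measurable fun z : ℂ => 1 - ‖z‖ ^ 2)
    exact ((AEMeasurable.mul (by fun_prop) h2.aemeasurable).mul h1.ennreal_ofReal).const_mul _
  rw [ffun_eq hα, hardyStein hp (by nlinarith) hf, sub_add_cancel, add_assoc,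
    hardyStein hp (by nlinarith) hf]
  gcongr
  refine le_trans ?_ (add_le_add_right le_add_self _)
  rw [← ENNReal.add_div]
  gcongr ?_ / _
  rw [← lintegral_const_mul' _ _ ENNReal.ofReal_ne_top,
    ← lintegral_const_mul' _ _ ENNReal.ofReal_ne_top,
    ← lintegral_const_mul' _ _ ENNReal.ofReal_ne_top, ← lintegral_add_left' hm]
  refine setLIntegral_mono' isOpen_unitDisk.measurableSet fun z hz => ?_
  have hy := one_sub_norm_sq_pos hz
  set q := p / 2 * (α + 2) with hq
  set y := 1 - ‖z‖ ^ 2 with hy'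
  have h1 : ENNReal.ofReal (p ^ 2 / 4) * ENNReal.ofReal (1 / q) ≤
      ENNReal.ofReal (p / 2) * kernelSeries (α + 2) y := by
    refine le_trans (le_of_eq ?_)
      (mul_le_mul_right (ofReal_one_div_le_kernelSeries (α + 2) y) _)
    rw [← ENNReal.ofReal_mul (by positivity), ← ENNReal.ofReal_mul (by positivity), hq]
    congr 1
    field_simp
    norm_num
  have h2 : ENNReal.ofReal (y ^ (q - 1 + 2)) = ENNReal.ofReal (y ^ q) * ENNReal.ofReal y := by
    rw [← ENNReal.ofReal_mul (by positivity), show q - 1 + 2 = q + 1 by ring, Real.rpow_add_one hy.ne']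
  rw [h2, kernelSeries_eq_add hy.le, show q - 1 + 2 = q + 1 by ring]
  set D := ENNReal.ofReal (‖deriv f z‖ ^ 2 * ‖f z‖ ^ (p - 2))
  calc _ = ENNReal.ofReal (p ^ 2 / 4) * ENNReal.ofReal (1 / q) * (ENNReal.ofReal (y ^ q) * D) +
        ENNReal.ofReal (p ^ 2 / 4) * (ENNReal.ofReal (y ^ q) * ENNReal.ofReal y *
          kernelSeries (q + 1) y * D) := by ring
    _ ≤ ENNReal.ofReal (p / 2) * kernelSeries (α + 2) y * (ENNReal.ofReal (y ^ q) * D) +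
        ENNReal.ofReal (p ^ 2 / 4) * (ENNReal.ofReal (y ^ q) * ENNReal.ofReal y *
          kernelSeries (q + 1) y * D) := by gcongr
    _ = _ := by ring

theorem a2norm_rpow_two (α : ℝ) (f : ℂ → ℂ) : A2norm α f ^ (2 : ℝ) = A2normSq α f := by
  rw [A2norm, ← ENNReal.rpow_mul]
  norm_num

theorem apNorm_rpow {p : ℝ} (hp : 0 < p) (b : ℝ) (f : ℂ → ℂ) :
    ApNorm p b f ^ p = ApIntPow p b f := by
  rw [ApNorm, ← ENNReal.rpow_mul, one_div, inv_mul_cancel₀ hp.ne', ENNReal.rpow_one]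

theorem a2norm_const_mul (α : ℝ) (c : ℂ) (f : ℂ → ℂ) :
    A2norm α (fun z => c * f z) = ENNReal.ofReal ‖c‖ * A2norm α f := by
  have : A2normSq α (fun z => c * f z) = ENNReal.ofReal (‖c‖ ^ 2) * A2normSq α f := by
    rw [A2normSq, A2normSq, ← ENNReal.tsum_mul_left]
    refine tsum_congr fun n => ?_
    rw [← ENNReal.ofReal_mul (by positivity)]
    congr 1
    simp only [taylorCoeff]
    rw [iteratedDeriv_const_mul_field, mul_div_assoc, norm_mul, mul_pow, mul_div_assoc]
  rw [A2norm, this, ENNReal.mul_rpow_of_nonneg _ _ (by norm_num), A2norm,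
    ENNReal.ofReal_rpow_of_nonneg (by positivity) (by norm_num), ← Real.rpow_natCast,
    ← Real.rpow_mul (norm_nonneg c)]
  norm_num

theorem ffun_const_mul (α : ℝ) {p : ℝ} (hp : 2 < p) (c : ℂ) (f : ℂ → ℂ) :
    Ffun α p (fun z => c * f z) = ENNReal.ofReal (‖c‖ ^ p) * Ffun α p f := by
  have hc : ‖c‖ ^ p = ‖c‖ ^ 2 * ‖c‖ ^ (p - 2) := by
    rcases eq_or_ne c 0 with rfl | hc
    · simp [Real.zero_rpow (show p ≠ 0 by linarith)]
    · rw [← Real.rpow_natCast, ← Real.rpow_add (norm_pos_iff.2 hc)]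
      norm_num
  rw [Ffun, Ffun, mul_add (ENNReal.ofReal _), norm_mul, Real.mul_rpow (norm_nonneg _) (norm_nonneg _),
    ENNReal.ofReal_mul (by positivity), ← mul_div_assoc (ENNReal.ofReal (‖c‖ ^ p)),
    mul_left_comm _ (ENNReal.ofReal (p / 2)),
    ← lintegral_const_mul' (ENNReal.ofReal (‖c‖ ^ p)) _ ENNReal.ofReal_ne_top]
  congr 3
  refine setLIntegral_congr_fun isOpen_unitDisk.measurableSet fun z hz => ?_
  rw [← mul_assoc, ← ENNReal.ofReal_mul (by positivity)]
  congr 2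
  rw [deriv_const_mul_field, norm_mul, norm_mul, Real.mul_rpow (norm_nonneg _) (norm_nonneg _), hc]
  ring

theorem rpow_sub_one_mul_le_one {s t : ℝ} (hs : 1 < s) (ht0 : 0 ≤ t) (ht1 : t ≤ 1) :
    t ^ s + s * t ^ (s - 1) * (1 - t) ≤ 1 := by
  rcases ht0.eq_or_lt with rfl | ht
  · simp [Real.zero_rpow (show s ≠ 0 by linarith), Real.zero_rpow (show s - 1 ≠ 0 by linarith)]
  · have h1 : t ^ s = t ^ (s - 1) * t := by rw [← Real.rpow_add_one ht.ne']; ring_nf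
    have h2 : s - (s - 1) * t ≤ t ^ (1 - s) := by
      rw [Real.rpow_def_of_pos ht]
      have h3 := Real.add_one_le_exp (Real.log t * (1 - s))
      have h4 := Real.log_le_sub_one_of_pos ht
      nlinarith
    have h5 : t ^ (s - 1) * t ^ (1 - s) = 1 := by
      rw [← Real.rpow_add ht]
      simp
    have h6 : 0 < t ^ (s - 1) := by positivity
    nlinarith

theorem taylorCoeff_one (n : ℕ) : taylorCoeff (fun _ => 1) n = if n = 0 then 1 else 0 := by
  rcases n with _ | n
  · simp [taylorCoeff]
  · simp [taylorCoeff, iteratedDeriv_const]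

theorem a2norm_one {α : ℝ} (hα : -1 ≤ α) : A2norm α (fun _ => 1) = 1 := by
  rw [A2norm, A2normSq, tsum_eq_single 0]
  · simp [taylorCoeff_one, ccoef_zero (show 0 < α + 2 by linarith)]
  · intro n hn
    simp [taylorCoeff_one, hn]

theorem ffun_one (α p : ℝ) : Ffun α p (fun _ => 1) = 1 := by
  simp [Ffun]

theorem ffun_le_one {α p : ℝ} (hα : -1 ≤ α) (hp : 2 < p) {g : ℂ → ℂ}
    (hg : DifferentiableOn ℂ g unitDisk) (h1 : A2norm α g = 1)
    (hmax : ∀ z ∈ unitDisk, ‖g z‖ * (1 - ‖z‖ ^ 2) ^ ((α + 2) / 2) ≤ ‖g 0‖) :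
    Ffun α p g ≤ 1 := by
  have hLP := littlewoodPaley (show -2 < α by linarith) hg
  rw [← a2norm_rpow_two, h1, ENNReal.one_rpow] at hLP
  set X := (∫⁻ z in unitDisk, ENNReal.ofReal ((1 - ‖z‖ ^ 2) ^ (α + 2)) *
        kernelSeries (α + 2) (1 - ‖z‖ ^ 2) * ENNReal.ofReal (‖deriv g z‖ ^ 2)) /
          ENNReal.ofReal Real.pi with hX
  set t := ‖g 0‖ ^ 2 with ht
  have ht0 : 0 ≤ t := by positivity
  have ht1 : t ≤ 1 := by
    have : ENNReal.ofReal t ≤ 1 := hLP ▸ le_self_add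
    simpa using this
  have hXe : X = ENNReal.ofReal (1 - t) := by
    rw [ENNReal.ofReal_sub _ ht0, ENNReal.ofReal_one, hLP,
      ENNReal.add_sub_cancel_left ENNReal.ofReal_ne_top]
  have hF : Ffun α p g ≤ ENNReal.ofReal (‖g 0‖ ^ p) +
      ENNReal.ofReal (p / 2) * (ENNReal.ofReal (‖g 0‖ ^ (p - 2)) * X) := by
    rw [ffun_eq hα, hX, mul_div_assoc, ← mul_div_assoc (ENNReal.ofReal (‖g 0‖ ^ (p - 2))),
      ← lintegral_const_mul' _ _ ENNReal.ofReal_ne_top]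
    gcongr _ + _ * (?_ / _)
    refine setLIntegral_mono' isOpen_unitDisk.measurableSet fun z hz => ?_
    have hy := one_sub_norm_sq_pos hz
    set y := 1 - ‖z‖ ^ 2 with hy'
    have e1 : y ^ (p / 2 * (α + 2)) * ‖g z‖ ^ (p - 2) ≤ ‖g 0‖ ^ (p - 2) * y ^ (α + 2) := by
      have : y ^ (p / 2 * (α + 2)) = (y ^ ((α + 2) / 2)) ^ (p - 2) * y ^ (α + 2) := by
        rw [← Real.rpow_mul hy.le, ← Real.rpow_add hy]
        congr 1
        ring
      rw [this, mul_right_comm, mul_comm (_ ^ (p - 2)),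
        ← Real.mul_rpow (norm_nonneg _) (by positivity)]
      gcongr
      exact hmax z hz
    calc _ = ENNReal.ofReal (y ^ (p / 2 * (α + 2)) * ‖g z‖ ^ (p - 2)) *
          (kernelSeries (α + 2) y * ENNReal.ofReal (‖deriv g z‖ ^ 2)) := by
          rw [ENNReal.ofReal_mul (by positivity), ENNReal.ofReal_mul (by positivity)]
          ring
      _ ≤ ENNReal.ofReal (‖g 0‖ ^ (p - 2) * y ^ (α + 2)) *
          (kernelSeries (α + 2) y * ENNReal.ofReal (‖deriv g z‖ ^ 2)) := by gcongr
      _ = _ := by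
          rw [ENNReal.ofReal_mul (by positivity)]
          ring
  refine hF.trans ?_
  have e2 : ∀ x : ℝ, ‖g 0‖ ^ x = t ^ (x / 2) := by
    intro x
    rw [ht, ← Real.rpow_natCast, ← Real.rpow_mul (norm_nonneg _)]
    congr 1
    push_cast
    ring
  rw [hXe, ← ENNReal.ofReal_mul (by positivity), ← ENNReal.ofReal_mul (by positivity),
    ← ENNReal.ofReal_add (by positivity) (by have : 0 ≤ 1 - t := by linarith
                                             positivity), e2, e2]
  refine ENNReal.ofReal_le_one.2 (le_trans (le_of_eq ?_)
    (rpow_sub_one_mul_le_one (s := p / 2) (by linarith) ht0 ht1))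
  rw [show (p - 2) / 2 = p / 2 - 1 by ring]
  ring

theorem eqOn_zero_of_a2norm_eq_zero {α : ℝ} (hα : -1 ≤ α) {f : ℂ → ℂ}
    (hf : DifferentiableOn ℂ f unitDisk) (h : A2norm α f = 0) : ∀ z ∈ unitDisk, f z = 0 := by
  intro z hz
  have h0 : A2normSq α f = 0 := by rw [← a2norm_rpow_two, h]; simp
  rw [A2normSq, ENNReal.tsum_eq_zero] at h0
  have h1 : ∀ n, taylorCoeff f n = 0 := by
    intro n
    have hc := ccoef_pos (show 0 < α + 2 by linarith) n
    have := ENNReal.ofReal_eq_zero.1 (h0 n)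
    have h2 : ‖taylorCoeff f n‖ ^ 2 ≤ 0 := by
      by_contra! h3
      exact absurd this (not_le.2 (by positivity))
    simpa using le_antisymm h2 (by positivity)
  have := hasSum_taylorCoeff hf hz
  simp only [h1, zero_mul] at this
  exact this.unique hasSum_zero

theorem ffun_le_a2norm_rpow {α p : ℝ} (hα : -1 ≤ α) (hp : 2 < p)
    (H : ∀ f : ℂ → ℂ, DifferentiableOn ℂ f unitDisk → A2norm α f = 1 → Ffun α p f ≤ 1)
    {f : ℂ → ℂ} (hf : DifferentiableOn ℂ f unitDisk) : Ffun α p f ≤ A2norm α f ^ p := by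
  rcases eq_or_ne (A2norm α f) ∞ with htop | htop
  · rw [htop, ENNReal.top_rpow_of_pos (by linarith)]
    exact le_top
  rcases eq_or_ne (A2norm α f) 0 with hz | hz
  · have h0 := eqOn_zero_of_a2norm_eq_zero hα hf hz
    refine le_of_eq_of_le ?_ zero_le
    have : ∫⁻ z in unitDisk, ENNReal.ofReal
        (‖deriv f z‖ ^ 2 * ‖f z‖ ^ (p - 2) * (1 - ‖z‖ ^ 2) ^ (p * (α + 2) / 2)) * Hinner α z = 0 := by
      rw [setLIntegral_congr_fun isOpen_unitDisk.measurableSet (g := 0) fun z hz => by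
        simp [h0 z hz, Real.zero_rpow (show p - 2 ≠ 0 by linarith)]]
      simp
    rw [Ffun, this, h0 0 (by simp [unitDisk])]
    simp [Real.zero_rpow (show p ≠ 0 by linarith)]
  set N := (A2norm α f).toReal with hN
  have hNe : A2norm α f = ENNReal.ofReal N := (ENNReal.ofReal_toReal htop).symm
  have hN0 : 0 < N := ENNReal.toReal_pos hz htop
  have hn : ‖((N⁻¹ : ℝ) : ℂ)‖ = N⁻¹ := by
    rw [Complex.norm_real, Real.norm_of_nonneg (by positivity)]
  have h1 : A2norm α (fun z => ((N⁻¹ : ℝ) : ℂ) * f z) = 1 := by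
    rw [a2norm_const_mul, hn, hNe, ← ENNReal.ofReal_mul (by positivity),
      inv_mul_cancel₀ hN0.ne', ENNReal.ofReal_one]
  have h2 := H _ (hf.const_mul _) h1
  rw [ffun_const_mul α hp, hn] at h2
  calc Ffun α p f = ENNReal.ofReal (N ^ p) * (ENNReal.ofReal (N⁻¹ ^ p) * Ffun α p f) := by
        rw [← mul_assoc, ← ENNReal.ofReal_mul (by positivity),
          ← Real.mul_rpow hN0.le (by positivity), mul_inv_cancel₀ hN0.ne']
        simp
    _ ≤ ENNReal.ofReal (N ^ p) * 1 := by gcongr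
    _ = _ := by rw [mul_one, hNe, ENNReal.ofReal_rpow_of_pos hN0]

/-- The involutive disk automorphism exchanging `0` and `a`, for real `a`. -/
def mobius (a : ℝ) (z : ℂ) : ℂ := (a - z) / (1 - a * z)

theorem one_sub_le_norm_one_sub_mul {a : ℝ} (ha : 0 ≤ a) {z : ℂ} (hz : z ∈ unitDisk) :
    1 - a ≤ ‖1 - a * z‖ := by
  have h1 : ‖(a : ℂ) * z‖ ≤ a := by
    rw [norm_mul, Complex.norm_real, Real.norm_of_nonneg ha]
    exact mul_le_of_le_one_right ha (mem_unitDisk.1 hz).le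
  have := norm_sub_norm_le (1 : ℂ) (a * z)
  rw [norm_one] at this
  linarith

theorem one_sub_mul_ne_zero {a : ℝ} (ha : 0 ≤ a) (ha1 : a < 1) {z : ℂ} (hz : z ∈ unitDisk) :
    1 - (a : ℂ) * z ≠ 0 := by
  have := one_sub_le_norm_one_sub_mul ha hz
  exact norm_pos_iff.1 (by linarith)

theorem norm_one_sub_mul_pos {a : ℝ} (ha : 0 ≤ a) (ha1 : a < 1) {z : ℂ} (hz : z ∈ unitDisk) :
    0 < ‖1 - (a : ℂ) * z‖ :=
  norm_pos_iff.2 (one_sub_mul_ne_zero ha ha1 hz)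

theorem one_sub_norm_sq_mobius {a : ℝ} (ha : 0 ≤ a) (ha1 : a < 1) {z : ℂ} (hz : z ∈ unitDisk) :
    1 - ‖mobius a z‖ ^ 2 = (1 - ‖z‖ ^ 2) * ((1 - a ^ 2) / ‖1 - (a : ℂ) * z‖ ^ 2) := by
  have h := norm_one_sub_mul_pos ha ha1 hz
  rw [mobius, norm_div, div_pow]
  field_simp
  simp only [← Complex.normSq_eq_norm_sq, Complex.normSq_apply]
  simp
  ring

theorem mobius_mem_unitDisk {a : ℝ} (ha : 0 ≤ a) (ha1 : a < 1) {z : ℂ} (hz : z ∈ unitDisk) :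
    mobius a z ∈ unitDisk := by
  have h1 := one_sub_norm_sq_mobius ha ha1 hz
  have h2 := one_sub_norm_sq_pos hz
  have h3 := norm_one_sub_mul_pos ha ha1 hz
  have h4 : 0 < 1 - a ^ 2 := by nlinarith
  have h5 : 0 < 1 - ‖mobius a z‖ ^ 2 := by rw [h1]; positivity
  rw [mem_unitDisk]
  nlinarith [norm_nonneg (mobius a z)]

theorem mobius_mobius {a : ℝ} (ha : 0 ≤ a) (ha1 : a < 1) {z : ℂ} (hz : z ∈ unitDisk) :
    mobius a (mobius a z) = z := by
  have h := one_sub_mul_ne_zero ha ha1 hz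
  have h4 : (1 - (a : ℂ) ^ 2) ≠ 0 := by
    have : (1 - a ^ 2 : ℝ) ≠ 0 := by nlinarith
    exact_mod_cast this
  have h5 : 1 - (a : ℂ) * ((a - z) / (1 - a * z)) = (1 - (a : ℂ) ^ 2) / (1 - a * z) := by
    field_simp
    ring
  rw [mobius, mobius, h5]
  field_simp
  ring

theorem hasDerivAt_mobius {a : ℝ} (ha : 0 ≤ a) (ha1 : a < 1) {z : ℂ} (hz : z ∈ unitDisk) :
    HasDerivAt (mobius a) (-((1 - a ^ 2) / (1 - a * z) ^ 2)) z := by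
  have h := one_sub_mul_ne_zero ha ha1 hz
  have h1 : HasDerivAt (fun z : ℂ => (a : ℂ) - z) (-1) z := (hasDerivAt_id z).const_sub _
  have h2 : HasDerivAt (fun z : ℂ => 1 - (a : ℂ) * z) (-a) z := by
    simpa using ((hasDerivAt_id z).const_mul (a : ℂ)).const_sub 1
  have h3 := h1.div h2 h
  refine (h3.congr_deriv ?_)
  field_simp
  ring

theorem abs_det_toSpanSingleton_restrictScalars (c : ℂ) :
    |((ContinuousLinearMap.toSpanSingleton ℂ c).restrictScalars ℝ).det| = ‖c‖ ^ 2 := by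
  have : (((ContinuousLinearMap.toSpanSingleton ℂ c).restrictScalars ℝ : ℂ →L[ℝ] ℂ) :
      ℂ →ₗ[ℝ] ℂ) = Algebra.lmul ℝ ℂ c := by
    ext
    all_goals simp [mul_comm]
  rw [ContinuousLinearMap.det, this, ← Algebra.norm_apply, Algebra.norm_complex_apply,
    Complex.normSq_eq_norm_sq, abs_of_nonneg (by positivity)]

theorem setLIntegral_mobius {a : ℝ} (ha : 0 ≤ a) (ha1 : a < 1) (G : ℂ → ℝ≥0∞) :
    ∫⁻ z in unitDisk, G z = ∫⁻ z in unitDisk,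
      ENNReal.ofReal (((1 - a ^ 2) / ‖1 - (a : ℂ) * z‖ ^ 2) ^ 2) * G (mobius a z) := by
  have himg : mobius a '' unitDisk = unitDisk := by
    refine Subset.antisymm (image_subset_iff.2 fun z hz => mobius_mem_unitDisk ha ha1 hz)
      fun z hz => ⟨mobius a z, mobius_mem_unitDisk ha ha1 hz, mobius_mobius ha ha1 hz⟩
  have hinj : InjOn (mobius a) unitDisk := fun z hz w hw h => by
    rw [← mobius_mobius ha ha1 hz, h, mobius_mobius ha ha1 hw]
  have main := lintegral_image_eq_lintegral_abs_det_fderiv_mul volume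
    isOpen_unitDisk.measurableSet
    (fun z hz => ((hasDerivAt_mobius ha ha1 hz).hasFDerivAt.restrictScalars ℝ).hasFDerivWithinAt)
    hinj G
  rw [himg] at main
  rw [main]
  refine setLIntegral_congr_fun isOpen_unitDisk.measurableSet fun z hz => ?_
  have h4 : 0 < 1 - a ^ 2 := by nlinarith
  have : ‖(1 - (a : ℂ) ^ 2)‖ = 1 - a ^ 2 := by
    rw [← Real.norm_of_nonneg h4.le, ← Complex.norm_real]
    push_cast
    rfl
  rw [abs_det_toSpanSingleton_restrictScalars, norm_neg, norm_div, norm_pow, this]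

/-- The weighted composition of `f` with `mobius a` that is isometric on the weighted Bergman
spaces of homogeneity `γ`. -/
def mobiusAct (γ a : ℝ) (f : ℂ → ℂ) (z : ℂ) : ℂ :=
  ((1 - a ^ 2) ^ (γ / 2) : ℝ) * (1 - (a : ℂ) * z) ^ ((-γ : ℝ) : ℂ) * f (mobius a z)

theorem norm_mobiusAct (γ : ℝ) {a : ℝ} (ha : 0 ≤ a) (ha1 : a < 1) (f : ℂ → ℂ) {z : ℂ}
    (hz : z ∈ unitDisk) : ‖mobiusAct γ a f z‖ =
      ((1 - a ^ 2) / ‖1 - (a : ℂ) * z‖ ^ 2) ^ (γ / 2) * ‖f (mobius a z)‖ := by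
  have h := norm_one_sub_mul_pos ha ha1 hz
  have h4 : 0 < 1 - a ^ 2 := by nlinarith
  rw [mobiusAct, norm_mul, norm_mul, Complex.norm_cpow_real, Complex.norm_real,
    Real.norm_of_nonneg (by positivity), Real.div_rpow h4.le (by positivity), Real.rpow_neg h.le,
    ← Real.rpow_natCast ‖_‖, ← Real.rpow_mul h.le, div_eq_mul_inv]
  congr 4
  push_cast
  ring

theorem differentiableOn_mobiusAct (γ : ℝ) {a : ℝ} (ha : 0 ≤ a) (ha1 : a < 1) {f : ℂ → ℂ}
    (hf : DifferentiableOn ℂ f unitDisk) : DifferentiableOn ℂ (mobiusAct γ a f) unitDisk := by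
  intro z hz
  have hfa : DifferentiableAt ℂ f (mobius a z) :=
    hf.differentiableAt (isOpen_unitDisk.mem_nhds (mobius_mem_unitDisk ha ha1 hz))
  have h1 : DifferentiableAt ℂ (fun z : ℂ => 1 - (a : ℂ) * z) z := by fun_prop
  have hs : 1 - (a : ℂ) * z ∈ Complex.slitPlane := by
    left
    have h2 : ((a : ℂ) * z).re ≤ ‖(a : ℂ) * z‖ := Complex.re_le_norm _
    have h3 : ‖(a : ℂ) * z‖ ≤ a := by
      rw [norm_mul, Complex.norm_real, Real.norm_of_nonneg ha]
      exact mul_le_of_le_one_right ha (mem_unitDisk.1 hz).le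
    rw [Complex.sub_re, Complex.one_re]
    linarith
  have h2 := h1.cpow_const (c := ((-γ : ℝ) : ℂ)) hs
  exact (((h2.const_mul _).mul
    (hfa.comp z (hasDerivAt_mobius ha ha1 hz).differentiableAt)).differentiableWithinAt)

theorem setLIntegral_norm_mobiusAct_rpow (γ p b : ℝ) {a : ℝ} (ha : 0 ≤ a) (ha1 : a < 1)
    (f : ℂ → ℂ) :
    ∫⁻ z in unitDisk, ENNReal.ofReal ((1 - ‖z‖ ^ 2) ^ b * ‖mobiusAct γ a f z‖ ^ p) =
      ∫⁻ z in unitDisk, ENNReal.ofReal ((1 - ‖mobius a z‖ ^ 2) ^ (b - (p / 2 * γ - 2)) *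
        ((1 - ‖z‖ ^ 2) ^ (p / 2 * γ - 2) * ‖f z‖ ^ p)) := by
  rw [setLIntegral_mobius ha ha1 (fun z => ENNReal.ofReal
    ((1 - ‖mobius a z‖ ^ 2) ^ (b - (p / 2 * γ - 2)) *
        ((1 - ‖z‖ ^ 2) ^ (p / 2 * γ - 2) * ‖f z‖ ^ p)))]
  refine setLIntegral_congr_fun isOpen_unitDisk.measurableSet fun z hz => ?_
  have h := norm_one_sub_mul_pos ha ha1 hz
  have h4 : 0 < 1 - a ^ 2 := by nlinarith
  have hy := one_sub_norm_sq_pos hz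
  rw [mobius_mobius ha ha1 hz, one_sub_norm_sq_mobius ha ha1 hz, norm_mobiusAct γ ha ha1 f hz,
    ← ENNReal.ofReal_mul (by positivity)]
  congr 1
  have hJ : 0 < (1 - a ^ 2) / ‖1 - (a : ℂ) * z‖ ^ 2 := by positivity
  set J := (1 - a ^ 2) / ‖1 - (a : ℂ) * z‖ ^ 2
  set y := 1 - ‖z‖ ^ 2
  rw [Real.mul_rpow (by positivity) (norm_nonneg _), Real.mul_rpow hy.le hJ.le,
    ← Real.rpow_mul hJ.le]
  have e1 : J ^ (γ / 2 * p) = J ^ 2 * J ^ (p / 2 * γ - 2) := by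
    rw [← Real.rpow_natCast, ← Real.rpow_add hJ]
    congr 1
    push_cast
    ring
  have e2 : y ^ b = y ^ (b - (p / 2 * γ - 2)) * y ^ (p / 2 * γ - 2) := by
    rw [← Real.rpow_add hy]
    congr 1
    ring
  rw [e1, e2]
  ring

theorem apIntPow_mobiusAct (γ p : ℝ) {a : ℝ} (ha : 0 ≤ a) (ha1 : a < 1) (f : ℂ → ℂ) :
    ApIntPow p (p / 2 * γ - 2) (mobiusAct γ a f) = ApIntPow p (p / 2 * γ - 2) f := by
  rw [ApIntPow, ApIntPow, setLIntegral_norm_mobiusAct_rpow γ p _ ha ha1]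
  simp

theorem ccoef_succ {β : ℝ} (hβ : 0 < β) (n : ℕ) :
    ccoef β (n + 1) = ccoef β n * ((n + β) / (n + 1)) := by
  have h1 : (0 : ℝ) < n + β := by positivity
  have h2 := Real.Gamma_pos_of_pos hβ
  have h3 : Real.Gamma (((n + 1 : ℕ) : ℝ) + β) = (n + β) * Real.Gamma (n + β) := by
    rw [← Real.Gamma_add_one h1.ne']
    congr 1
    push_cast
    ring
  rw [ccoef, ccoef, h3, Nat.factorial_succ]
  push_cast
  have : (n.factorial : ℝ) ≠ 0 := by positivity
  field_simp

theorem ccoef_mono {β β' : ℝ} (hβ : 0 < β) (h : β ≤ β') (n : ℕ) : ccoef β n ≤ ccoef β' n := by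
  induction n with
  | zero => rw [ccoef_zero hβ, ccoef_zero (hβ.trans_le h)]
  | succ n ih =>
    rw [ccoef_succ hβ, ccoef_succ (hβ.trans_le h)]
    have h1 := (ccoef_pos hβ n).le
    have h2 := h1.trans ih
    gcongr

theorem continuousAt_ccoef {β : ℝ} (hβ : 0 < β) (n : ℕ) :
    ContinuousAt (fun β => ccoef β n) β := by
  have hG : ∀ x : ℝ, 0 < x → ContinuousAt Real.Gamma x := fun x hx =>
    (Real.differentiableAt_Gamma fun m => by
      have : (0 : ℝ) ≤ m := m.cast_nonneg
      linarith).continuousAt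
  have h1 : ContinuousAt (fun β : ℝ => Real.Gamma (n + β)) β :=
    (hG _ (by positivity)).comp (f := fun β : ℝ => (n : ℝ) + β) (by fun_prop)
  refine h1.div ((hG β hβ).mul continuousAt_const) ?_
  have := Real.Gamma_pos_of_pos hβ
  positivity

theorem a2normSq_anti {α α' : ℝ} (hα : -2 < α) (h : α ≤ α') (f : ℂ → ℂ) :
    A2normSq α' f ≤ A2normSq α f := by
  refine ENNReal.tsum_le_tsum fun n => ENNReal.ofReal_le_ofReal ?_
  have := ccoef_pos (show 0 < α + 2 by linarith) n
  gcongr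
  exact ccoef_mono (by linarith) (by linarith) n

theorem a2normSq_mobiusAct_le_rpow_mul {γ δ a : ℝ} (hγ : 1 ≤ γ) (hδ : 0 < δ) (ha : 0 ≤ a)
    (ha1 : a < 1) {f : ℂ → ℂ} (hf : DifferentiableOn ℂ f unitDisk) :
    A2normSq (γ + δ - 2) (mobiusAct γ a f) ≤
      ENNReal.ofReal (((1 + a) / (1 - a)) ^ δ) * A2normSq (γ - 2) f := by
  have hb : -1 < γ + δ - 2 := by linarith
  refine le_trans ?_ (mul_le_mul_right (a2normSq_anti (show -2 < γ - 2 by linarith)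
    (show γ - 2 ≤ γ + δ - 2 by linarith) f) _)
  rw [← apIntPow_two hb (differentiableOn_mobiusAct γ ha ha1 hf), ← apIntPow_two hb hf,
    ApIntPow, ApIntPow, setLIntegral_norm_mobiusAct_rpow γ 2 _ ha ha1, mul_div_assoc,
    mul_div_assoc, mul_left_comm, ← mul_div_assoc (ENNReal.ofReal (_ ^ δ)),
    ← lintegral_const_mul' _ _ ENNReal.ofReal_ne_top]
  gcongr _ * (?_ / _)
  refine setLIntegral_mono' isOpen_unitDisk.measurableSet fun z hz => ?_
  have hy := one_sub_norm_sq_pos hz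
  have h := one_sub_le_norm_one_sub_mul ha hz
  have hp := norm_one_sub_mul_pos ha ha1 hz
  have ha' : 0 < 1 - a := by linarith
  have h4 : 0 < 1 - a ^ 2 := by nlinarith
  rw [← ENNReal.ofReal_mul (by positivity), one_sub_norm_sq_mobius ha ha1 hz]
  refine ENNReal.ofReal_le_ofReal ?_
  set y := 1 - ‖z‖ ^ 2
  have hJ : (1 - a ^ 2) / ‖1 - (a : ℂ) * z‖ ^ 2 ≤ (1 + a) / (1 - a) := by
    rw [div_le_div_iff₀ (by positivity) ha']
    nlinarith [mul_le_mul h h ha'.le hp.le]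
  have e : y ^ (γ + δ - 2) = y ^ δ * y ^ (2 / 2 * γ - 2) := by
    rw [← Real.rpow_add hy]
    congr 1
    ring
  rw [show γ + δ - 2 - (2 / 2 * γ - 2) = δ by ring, e, Real.mul_rpow hy.le (by positivity)]
  calc _ ≤ y ^ δ * ((1 + a) / (1 - a)) ^ δ * (y ^ (2 / 2 * γ - 2) * ‖f z‖ ^ (2 : ℝ)) := by
        gcongr
    _ = _ := by ring

theorem a2normSq_mobiusAct_le {γ a : ℝ} (hγ : 1 ≤ γ) (ha : 0 ≤ a) (ha1 : a < 1) {f : ℂ → ℂ}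
    (hf : DifferentiableOn ℂ f unitDisk) :
    A2normSq (γ - 2) (mobiusAct γ a f) ≤ A2normSq (γ - 2) f := by
  rw [A2normSq, ENNReal.tsum_eq_iSup_nat]
  refine iSup_le fun N => ?_
  have hK : 0 < (1 + a) / (1 - a) := div_pos (by linarith) (by linarith)
  have hnhds : Tendsto (fun δ : ℝ => γ - 2 + δ + 2) (𝓝[>] 0) (𝓝 (γ - 2 + 2)) := by
    refine Tendsto.mono_left ?_ nhdsWithin_le_nhds
    exact Continuous.tendsto' (by fun_prop) _ _ (by ring)
  have h1 : Tendsto (fun δ : ℝ => ∑ n ∈ Finset.range N,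
      ENNReal.ofReal (‖taylorCoeff (mobiusAct γ a f) n‖ ^ 2 / ccoef (γ - 2 + δ + 2) n)) (𝓝[>] 0)
      (𝓝 (∑ n ∈ Finset.range N,
        ENNReal.ofReal (‖taylorCoeff (mobiusAct γ a f) n‖ ^ 2 / ccoef (γ - 2 + 2) n))) := by
    refine tendsto_finsetSum _ fun n _ => ENNReal.tendsto_ofReal ?_
    have hpos : 0 < γ - 2 + 2 := by linarith
    exact tendsto_const_nhds.div ((continuousAt_ccoef hpos n).tendsto.comp hnhds)
      (ccoef_pos hpos n).ne'
  have h2 : Tendsto (fun δ : ℝ => ENNReal.ofReal (((1 + a) / (1 - a)) ^ δ) * A2normSq (γ - 2) f)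
      (𝓝[>] 0) (𝓝 (A2normSq (γ - 2) f)) := by
    have h3 : Tendsto (fun δ : ℝ => ENNReal.ofReal (((1 + a) / (1 - a)) ^ δ)) (𝓝[>] 0) (𝓝 1) := by
      refine Tendsto.mono_left ?_ nhdsWithin_le_nhds
      have := ENNReal.tendsto_ofReal
        ((Real.continuous_const_rpow hK.ne').tendsto' (0 : ℝ) _ (Real.rpow_zero _))
      simpa using this
    simpa using ENNReal.Tendsto.mul_const h3 (Or.inl one_ne_zero)
  refine le_of_tendsto_of_tendsto h1 h2 ?_
  filter_upwards [self_mem_nhdsWithin] with δ hδ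
  refine le_trans ?_ (a2normSq_mobiusAct_le_rpow_mul hγ hδ ha ha1 hf)
  rw [A2normSq, show γ + δ - 2 = γ - 2 + δ by ring]
  exact ENNReal.sum_le_tsum _

theorem a2norm_mobiusAct_le {α a : ℝ} (hα : -1 ≤ α) (ha : 0 ≤ a) (ha1 : a < 1) {f : ℂ → ℂ}
    (hf : DifferentiableOn ℂ f unitDisk) : A2norm α (mobiusAct (α + 2) a f) ≤ A2norm α f := by
  have := a2normSq_mobiusAct_le (show 1 ≤ α + 2 by linarith) ha ha1 hf
  rw [add_sub_cancel_right] at this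
  exact ENNReal.rpow_le_rpow this (by norm_num)

theorem exists_seq_unitInterval_tendsto_one :
    ∃ r : ℕ → ℝ, (∀ n, 0 ≤ r n) ∧ (∀ n, r n < 1) ∧ Tendsto r atTop (𝓝 1) := by
  refine ⟨fun n => 1 - 1 / ((n : ℝ) + 1), fun n => ?_, fun n => ?_, ?_⟩
  · rw [sub_nonneg, div_le_one (by positivity)]
    linarith [n.cast_nonneg (α := ℝ)]
  · have : 0 < 1 / ((n : ℝ) + 1) := by positivity
    linarith
  · simpa using tendsto_one_div_add_atTop_nhds_zero_nat.const_sub (1 : ℝ)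

theorem tendsto_apIntPow_mobiusAct {α p : ℝ} (hα : -1 ≤ α) (hp : 2 < p) {f : ℂ → ℂ}
    (hf : DifferentiableOn ℂ f unitDisk) (hfin : ApIntPow p (p / 2 * (α + 2) - 2) f ≠ ∞)
    {a : ℕ → ℝ} (ha0 : ∀ n, 0 ≤ a n) (ha1 : ∀ n, a n < 1) (ha : Tendsto a atTop (𝓝 1)) :
    Tendsto (fun n => ApIntPow p (p / 2 * (α + 2) - 1) (mobiusAct (α + 2) (a n) f))
      atTop (𝓝 0) := by
  have hq : 1 < p / 2 * (α + 2) := by nlinarith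
  have hI : ∫⁻ z in unitDisk, ENNReal.ofReal ((1 - ‖z‖ ^ 2) ^ (p / 2 * (α + 2) - 2) * ‖f z‖ ^ p)
      ≠ ∞ := by
    intro h
    rw [ApIntPow, h, ENNReal.mul_top (by simp; linarith), ENNReal.top_div_of_ne_top
      ENNReal.ofReal_ne_top] at hfin
    exact hfin rfl
  have hmain : Tendsto (fun n => ∫⁻ z in unitDisk, ENNReal.ofReal
      ((1 - ‖mobius (a n) z‖ ^ 2) * ((1 - ‖z‖ ^ 2) ^ (p / 2 * (α + 2) - 2) * ‖f z‖ ^ p)))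
      atTop (𝓝 0) := by
    rw [← lintegral_zero (μ := volume.restrict unitDisk)]
    refine tendsto_lintegral_of_dominated_convergence' _ (fun n => ?_) (fun n => ?_) hI ?_
    · have hc : ContinuousOn (fun z => (1 - ‖mobius (a n) z‖ ^ 2) *
          ((1 - ‖z‖ ^ 2) ^ (p / 2 * (α + 2) - 2) * ‖f z‖ ^ p)) unitDisk := by
        have h1 : ContinuousOn (mobius (a n)) unitDisk := fun z hz =>
          (hasDerivAt_mobius (ha0 n) (ha1 n) hz).continuousAt.continuousWithinAt
        have h2 : ContinuousOn (fun z : ℂ => (1 - ‖z‖ ^ 2) ^ (p / 2 * (α + 2) - 2)) unitDisk :=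
          ContinuousOn.rpow_const (by fun_prop) fun z hz => Or.inl (one_sub_norm_sq_pos hz).ne'
        exact (continuousOn_const.sub (h1.norm.pow 2)).mul
          (h2.mul (hf.continuousOn.norm.rpow_const fun z _ => Or.inr (by linarith)))
      exact (hc.aemeasurable isOpen_unitDisk.measurableSet).ennreal_ofReal
    · refine (ae_restrict_iff' isOpen_unitDisk.measurableSet).2 (ae_of_all _ fun z hz => ?_)
      refine ENNReal.ofReal_le_ofReal ?_
      have hy := one_sub_norm_sq_pos hz
      refine mul_le_of_le_one_left (by positivity) ?_
      linarith [sq_nonneg ‖mobius (a n) z‖]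
    · refine (ae_restrict_iff' isOpen_unitDisk.measurableSet).2 (ae_of_all _ fun z hz => ?_)
      have hz1 : 1 - ((1 : ℝ) : ℂ) * z ≠ 0 := by
        intro h
        have h0 : z = 1 := by
          rw [Complex.ofReal_one] at h
          linear_combination -h
        simp [mem_unitDisk, h0] at hz
      have hm : Tendsto (fun n => mobius (a n) z) atTop (𝓝 (mobius 1 z)) := by
        have hnum : ContinuousAt (fun a : ℝ => (a : ℂ) - z) 1 := by fun_prop
        have hden : ContinuousAt (fun a : ℝ => 1 - (a : ℂ) * z) 1 := by fun_prop
        exact (hnum.div hden hz1).tendsto.comp ha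
      have hv : mobius 1 z = 1 := by
        rw [mobius]
        simp only [Complex.ofReal_one, one_mul] at hz1 ⊢
        exact div_self hz1
      rw [hv] at hm
      have h3 := ENNReal.tendsto_ofReal (((hm.norm.pow 2).const_sub 1).mul_const
        ((1 - ‖z‖ ^ 2) ^ (p / 2 * (α + 2) - 2) * ‖f z‖ ^ p))
      simpa using h3
  have h4 : Tendsto (fun n => ENNReal.ofReal (p / 2 * (α + 2) - 1 + 1) *
      (∫⁻ z in unitDisk, ENNReal.ofReal
      ((1 - ‖mobius (a n) z‖ ^ 2) * ((1 - ‖z‖ ^ 2) ^ (p / 2 * (α + 2) - 2) * ‖f z‖ ^ p))) /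
        ENNReal.ofReal Real.pi) atTop (𝓝 0) := by
    have h5 := ENNReal.Tendsto.div_const
      (ENNReal.Tendsto.const_mul (a := ENNReal.ofReal (p / 2 * (α + 2) - 1 + 1)) hmain
      (Or.inr ENNReal.ofReal_ne_top)) (b := ENNReal.ofReal Real.pi)
      (Or.inr (by simp [Real.pi_pos]))
    simpa using h5
  refine h4.congr fun n => ?_
  rw [ApIntPow, setLIntegral_norm_mobiusAct_rpow _ _ _ (ha0 n) (ha1 n)]
  rw [show p / 2 * (α + 2) - 1 - (p / 2 * (α + 2) - 2) = 1 by ring]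
  simp only [Real.rpow_one]

theorem apIntPow_le_a2norm_rpow_of_ne_top {α p : ℝ} (hα : -1 ≤ α) (hp : 2 < p)
    (H : ∀ f : ℂ → ℂ, DifferentiableOn ℂ f unitDisk → A2norm α f = 1 → Ffun α p f ≤ 1)
    {f : ℂ → ℂ} (hf : DifferentiableOn ℂ f unitDisk)
    (hfin : ApIntPow p (p / 2 * (α + 2) - 2) f ≠ ∞) :
    ApIntPow p (p / 2 * (α + 2) - 2) f ≤ A2norm α f ^ p := by
  obtain ⟨a, ha0, ha1, ha⟩ := exists_seq_unitInterval_tendsto_one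
  have h := (tendsto_apIntPow_mobiusAct hα hp hf hfin ha0 ha1 ha).const_add (A2norm α f ^ p)
  rw [add_zero] at h
  refine ge_of_tendsto' h fun n => ?_
  have hfa := differentiableOn_mobiusAct (α + 2) (ha0 n) (ha1 n) hf
  calc _ = ApIntPow p (p / 2 * (α + 2) - 2) (mobiusAct (α + 2) (a n) f) :=
        (apIntPow_mobiusAct _ _ (ha0 n) (ha1 n) f).symm
    _ ≤ _ := apIntPow_le_ffun_add hα hp hfa
    _ ≤ _ := by
        gcongr
        exact (ffun_le_a2norm_rpow hα hp H hfa).trans (ENNReal.rpow_le_rpow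
          (a2norm_mobiusAct_le hα (ha0 n) (ha1 n) hf) (by linarith))

theorem iteratedDeriv_dilation (c : ℂ) (f : ℂ → ℂ) (n : ℕ) :
    iteratedDeriv n (fun z => f (c * z)) = fun z => c ^ n * iteratedDeriv n f (c * z) := by
  induction n with
  | zero => simp
  | succ n ih =>
    ext z
    rw [iteratedDeriv_succ, ih, deriv_const_mul_field, iteratedDeriv_succ,
      deriv_comp_mul_left c (iteratedDeriv n f), smul_eq_mul, pow_succ, mul_assoc]

theorem a2norm_dilation_le {α r : ℝ} (hα : -1 ≤ α) (hr : 0 ≤ r) (hr1 : r ≤ 1) (f : ℂ → ℂ) :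
    A2norm α (fun z => f (r * z)) ≤ A2norm α f := by
  refine ENNReal.rpow_le_rpow (ENNReal.tsum_le_tsum fun n => ENNReal.ofReal_le_ofReal ?_)
    (by norm_num)
  have := ccoef_pos (show 0 < α + 2 by linarith) n
  gcongr
  simp only [taylorCoeff, iteratedDeriv_dilation, mul_zero]
  rw [mul_div_assoc, norm_mul,
    norm_pow, Complex.norm_real, Real.norm_of_nonneg hr]
  exact mul_le_of_le_one_left (norm_nonneg _) (pow_le_one₀ hr hr1)

theorem mul_mem_unitDisk {r : ℝ} (hr : 0 ≤ r) (hr1 : r ≤ 1) {z : ℂ} (hz : z ∈ unitDisk) :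
    (r : ℂ) * z ∈ unitDisk := by
  rw [mem_unitDisk, norm_mul, Complex.norm_real, Real.norm_of_nonneg hr]
  exact (mul_le_of_le_one_left (norm_nonneg _) hr1).trans_lt (mem_unitDisk.1 hz)

theorem differentiableOn_dilation {r : ℝ} (hr : 0 ≤ r) (hr1 : r ≤ 1) {f : ℂ → ℂ}
    (hf : DifferentiableOn ℂ f unitDisk) :
    DifferentiableOn ℂ (fun z => f (r * z)) unitDisk :=
  hf.comp (by fun_prop) fun _ hz => mul_mem_unitDisk hr hr1 hz

theorem apIntPow_ne_top_of_bounded {p b M : ℝ} (hp : 0 ≤ p) (hb : -1 < b) {f : ℂ → ℂ}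
    (hM : ∀ z ∈ unitDisk, ‖f z‖ ≤ M) : ApIntPow p b f ≠ ∞ := by
  have h1 : ApIntPow 2 b (fun _ => 1) = 1 := by
    rw [apIntPow_two hb (differentiableOn_const 1), ← a2norm_rpow_two, a2norm_one hb.le,
      ENNReal.one_rpow]
  have hM0 : 0 ≤ M := (norm_nonneg _).trans (hM 0 (by simp [unitDisk]))
  have h2 : ApIntPow p b f ≤ ENNReal.ofReal (M ^ p) * ApIntPow 2 b (fun _ => 1) := by
    rw [ApIntPow, ApIntPow, ← mul_div_assoc (ENNReal.ofReal (M ^ p)),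
      mul_left_comm (ENNReal.ofReal (M ^ p)),
      ← lintegral_const_mul' (ENNReal.ofReal (M ^ p)) _ ENNReal.ofReal_ne_top]
    gcongr _ * ?_ / _
    refine setLIntegral_mono' isOpen_unitDisk.measurableSet fun z hz => ?_
    have hy := one_sub_norm_sq_pos hz
    rw [← ENNReal.ofReal_mul (by positivity), norm_one, Real.one_rpow, mul_one,
      mul_comm (M ^ p)]
    have := hM z hz
    gcongr
  rw [h1, mul_one] at h2
  exact ne_top_of_le_ne_top ENNReal.ofReal_ne_top h2

theorem apIntPow_dilation_ne_top {p b r : ℝ} (hp : 0 ≤ p) (hb : -1 < b) (hr : 0 ≤ r)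
    (hr1 : r < 1) {f : ℂ → ℂ} (hf : DifferentiableOn ℂ f unitDisk) :
    ApIntPow p b (fun z => f (r * z)) ≠ ∞ := by
  have hsub : Metric.closedBall (0 : ℂ) r ⊆ unitDisk := Metric.closedBall_subset_ball hr1
  obtain ⟨M, hM⟩ := (isCompact_closedBall (0 : ℂ) r).exists_bound_of_continuousOn
    (hf.continuousOn.mono hsub)
  refine apIntPow_ne_top_of_bounded (M := M) hp hb fun z hz => hM _ ?_
  rw [mem_closedBall_zero_iff, norm_mul, Complex.norm_real, Real.norm_of_nonneg hr]
  exact mul_le_of_le_one_right hr (mem_unitDisk.1 hz).le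

theorem apIntPow_le_of_forall_dilation_le {p b : ℝ} (hp : 0 ≤ p) (hb : -1 < b) {f : ℂ → ℂ}
    (hf : DifferentiableOn ℂ f unitDisk) {B : ℝ≥0∞}
    (hB : ∀ r : ℝ, 0 ≤ r → r < 1 → ApIntPow p b (fun z => f (r * z)) ≤ B) :
    ApIntPow p b f ≤ B := by
  set C := ENNReal.ofReal (b + 1) / ENNReal.ofReal Real.pi with hC
  have hpi : ENNReal.ofReal Real.pi ≠ 0 := by simp [Real.pi_pos]
  have hC0 : C ≠ 0 := ENNReal.div_ne_zero.2 ⟨by simp; linarith, ENNReal.ofReal_ne_top⟩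
  have hCt : C ≠ ∞ := ENNReal.div_ne_top ENNReal.ofReal_ne_top hpi
  have key : ∀ g : ℂ → ℂ, ApIntPow p b g ≤ B ↔
      ∫⁻ z in unitDisk, ENNReal.ofReal ((1 - ‖z‖ ^ 2) ^ b * ‖g z‖ ^ p) ≤ B / C := by
    intro g
    rw [ENNReal.le_div_iff_mul_le (Or.inl hC0) (Or.inl hCt), ApIntPow, hC, mul_comm,
      mul_div_assoc]
  rw [key]
  obtain ⟨r, hr0, hr1, hr⟩ := exists_seq_unitInterval_tendsto_one
  have hw : ContinuousOn (fun z : ℂ => (1 - ‖z‖ ^ 2) ^ b) unitDisk :=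
    ContinuousOn.rpow_const (by fun_prop) fun z hz => Or.inl (one_sub_norm_sq_pos hz).ne'
  calc ∫⁻ z in unitDisk, ENNReal.ofReal ((1 - ‖z‖ ^ 2) ^ b * ‖f z‖ ^ p)
      = ∫⁻ z in unitDisk, liminf (fun n =>
          ENNReal.ofReal ((1 - ‖z‖ ^ 2) ^ b * ‖f (r n * z)‖ ^ p)) atTop := by
        refine setLIntegral_congr_fun isOpen_unitDisk.measurableSet fun z hz => ?_
        refine (Tendsto.liminf_eq (ENNReal.tendsto_ofReal (Tendsto.const_mul _ ?_))).symm
        refine Tendsto.rpow_const (Tendsto.norm ?_) (Or.inr hp)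
        have hfz := (hf.differentiableAt (isOpen_unitDisk.mem_nhds hz)).continuousAt
        have h1 : Tendsto (fun n => (r n : ℂ) * z) atTop (𝓝 z) := by
          have := ((Complex.continuous_ofReal.tendsto 1).comp hr).mul_const z
          simpa using this
        exact hfz.tendsto.comp h1
    _ ≤ liminf (fun n => ∫⁻ z in unitDisk,
          ENNReal.ofReal ((1 - ‖z‖ ^ 2) ^ b * ‖f (r n * z)‖ ^ p)) atTop := by
        refine lintegral_liminf_le' fun n => ?_
        have hc := (differentiableOn_dilation (hr0 n) (hr1 n).le hf).continuousOn
        exact ((hw.mul (hc.norm.rpow_const fun z _ => Or.inr hp)).aemeasurable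
          isOpen_unitDisk.measurableSet).ennreal_ofReal
    _ ≤ B / C := by
        refine liminf_le_of_frequently_le' (Frequently.of_forall fun n => ?_)
        exact (key _).1 (hB (r n) (hr0 n) (hr1 n))

theorem apIntPow_le_a2norm_rpow {α p : ℝ} (hα : -1 ≤ α) (hp : 2 < p)
    (H : ∀ f : ℂ → ℂ, DifferentiableOn ℂ f unitDisk → A2norm α f = 1 → Ffun α p f ≤ 1)
    {f : ℂ → ℂ} (hf : DifferentiableOn ℂ f unitDisk) :
    ApIntPow p (p / 2 * (α + 2) - 2) f ≤ A2norm α f ^ p := by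
  have hb : -1 < p / 2 * (α + 2) - 2 := by nlinarith
  refine apIntPow_le_of_forall_dilation_le (by linarith) hb hf fun r hr hr1 => ?_
  exact (apIntPow_le_a2norm_rpow_of_ne_top hα hp H (differentiableOn_dilation hr hr1.le hf)
    (apIntPow_dilation_ne_top (by linarith) hb hr hr1 hf)).trans
    (ENNReal.rpow_le_rpow (a2norm_dilation_le hα hr hr1.le f) (by linarith))

/-- the inclusion A²_α ⊂ A^p_{(p/2)(α+2)-2} is contractive iff for every
normalized f there is a normalized g whose weighted modulus attains its maximum at 0
and F_p(f) ≤ F_p(g). -/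
theorem statement5 (α p : ℝ) (hα : -1 ≤ α) (hp : 2 < p) :
    (∀ f : ℂ → ℂ, DifferentiableOn ℂ f unitDisk →
        ApNorm p (p / 2 * (α + 2) - 2) f ≤ A2norm α f) ↔
      (∀ f : ℂ → ℂ, DifferentiableOn ℂ f unitDisk → A2norm α f = 1 →
        ∃ g : ℂ → ℂ, DifferentiableOn ℂ g unitDisk ∧ A2norm α g = 1 ∧
          (∀ z ∈ unitDisk, ‖g z‖ * (1 - ‖z‖ ^ 2) ^ ((α + 2) / 2) ≤ ‖g 0‖) ∧
          Ffun α p f ≤ Ffun α p g) := by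
  have hp0 : 0 < p := by linarith
  constructor
  · intro h f hf h1
    refine ⟨fun _ => 1, differentiableOn_const 1, a2norm_one hα, fun z hz => ?_, ?_⟩
    · rw [norm_one, one_mul]
      exact Real.rpow_le_one (one_sub_norm_sq_nonneg hz) (by linarith [sq_nonneg ‖z‖])
        (by linarith)
    · rw [ffun_one]
      refine (ffun_le_apIntPow hα hp hf).trans ?_
      rw [← apNorm_rpow hp0]
      refine (ENNReal.rpow_le_rpow (h f hf) hp0.le).trans ?_
      rw [h1, ENNReal.one_rpow]
  · intro h f hf
    have H : ∀ f : ℂ → ℂ, DifferentiableOn ℂ f unitDisk → A2norm α f = 1 → Ffun α p f ≤ 1 := by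
      intro f hf h1
      obtain ⟨g, hg, hg1, hmax, hle⟩ := h f hf h1
      exact hle.trans (ffun_le_one hα hp hg hg1 hmax)
    rw [← ENNReal.rpow_le_rpow_iff hp0, apNorm_rpow hp0]
    exact apIntPow_le_a2norm_rpow hα hp H hf

end
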